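/- arXiv:2109.15148 — 2 statements merged into one kernel-verified Lean document; each statement's English description precedes it below -/
import Mathlib

section
/- There exist constants c₁, c₂ > 0 and n₀ such that for every n ≥ n₀: every simple graph on n vertices containing no copy of K'_{3,25} has at most c₂·n^{4/3} edges, and there exists a simple graph on n vertices containing no copy of K'_{3,25} with at least c₁·n^{4/3} edges. In other words, ex(n, K'_{3,25}) = Θ(n^{4/3}). -/
/-- The 1-subdivision of `K_{3,25}`: vertices are the three left vertices (`Fin 3`),
the 25 right vertices (`Fin 25`), and one subdivision vertex for each pair
(`Fin 3 × Fin 25`); each subdivision vertex `(i, j)` is joined to `a_i` and `b_j`. -/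
def KsubThreeTwentyFive : SimpleGraph (Fin 3 ⊕ Fin 25 ⊕ Fin 3 × Fin 25) :=
  SimpleGraph.fromRel (fun u v =>
    match u, v with
    | Sum.inl i, Sum.inr (Sum.inr ij) => i = ij.1
    | Sum.inr (Sum.inl j), Sum.inr (Sum.inr ij) => j = ij.2
    | _, _ => False)

/-- `G` contains a copy of `H`. -/
def ContainsCopy {α β : Type*} (G : SimpleGraph α) (H : SimpleGraph β) : Prop :=
  ∃ f : β → α, Function.Injective f ∧ ∀ u v, H.Adj u v → G.Adj (f u) (f v)

theorem containsCopy_of_paths {V : Type*} {H : SimpleGraph V}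
    (htf : ∀ u v w, H.Adj u v → H.Adj v w → ¬ H.Adj u w)
    {a : Fin 3 → V} {b : Fin 25 → V} {c : Fin 3 × Fin 25 → V}
    (ha : Function.Injective a) (hb : Function.Injective b) (hc : Function.Injective c)
    (hab : ∀ i j, a i ≠ b j) (hac : ∀ p, H.Adj (a p.1) (c p)) (hbc : ∀ p, H.Adj (b p.2) (c p)) :
    ContainsCopy H KsubThreeTwentyFive := by
  have hca : ∀ p i, c p ≠ a i := fun p i h =>
    htf (b p.2) (c p) (c (i, p.2)) (hbc p) (h ▸ hac (i, p.2)) (hbc (i, p.2))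
  have hcb : ∀ p j, c p ≠ b j := fun p j h =>
    htf (a p.1) (c p) (c (p.1, j)) (hac p) (h ▸ hbc (p.1, j)) (hac (p.1, j))
  refine ⟨Sum.elim a (Sum.elim b c), ?_, ?_⟩
  · refine ha.sumElim (hb.sumElim hc fun j p h => hcb p j h.symm) ?_
    rintro i (j | p) h
    · exact hab i j h
    · exact hca p i h.symm
  · rintro (i | j | p) (i' | j' | p') h <;>
      simp only [KsubThreeTwentyFive, SimpleGraph.fromRel_adj, or_false, false_or, and_false,
        or_self] at h
    · obtain ⟨-, rfl⟩ := h
      exact hac p'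
    · obtain ⟨-, rfl⟩ := h
      exact hbc p'
    · obtain ⟨-, rfl⟩ := h
      exact (hac p).symm
    · obtain ⟨-, rfl⟩ := h
      exact (hbc p).symm

section Counting

variable {V : Type*} [Fintype V] [DecidableEq V] (H : SimpleGraph V) [DecidableRel H.Adj]

/-- The set of common neighbours of two vertices. -/
def commonNbrs (u v : V) : Finset V := H.neighborFinset u ∩ H.neighborFinset v

/-- Two distinct vertices form a light pair if they have between 1 and 74 common neighbours. -/
def IsLight (u v : V) : Prop :=
  u ≠ v ∧ (commonNbrs H u v).Nonempty ∧ (commonNbrs H u v).card ≤ 74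

instance : DecidableRel (IsLight H) := fun _ _ => inferInstanceAs (Decidable (_ ∧ _ ∧ _))

/-- The vertices forming a light pair with `u`. -/
def lightNbrs (u : V) : Finset V := Finset.univ.filter (IsLight H u)

/-- The ordered light pairs inside a set. -/
def lightPairs (B : Finset V) : Finset (V × V) := (B ×ˢ B).filter fun p => IsLight H p.1 p.2

/-- The vertices joined by light pairs to all the `τ i`, without a common neighbour shared
by two of the `τ i`. -/
def rootedCenters (τ : Fin 3 → V) : Finset V :=
  Finset.univ.filter fun b => (∀ i, IsLight H b (τ i)) ∧
    ∀ i j, i ≠ j → ∀ c, H.Adj b c → H.Adj (τ i) c → ¬ H.Adj (τ j) c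

variable {H}

theorem mem_commonNbrs {u v w : V} : w ∈ commonNbrs H u v ↔ H.Adj u w ∧ H.Adj v w := by
  simp [commonNbrs]

theorem commonNbrs_comm (u v : V) : commonNbrs H u v = commonNbrs H v u :=
  Finset.inter_comm _ _

theorem IsLight.symm {u v : V} (h : IsLight H u v) : IsLight H v u := by
  unfold IsLight at *
  rw [commonNbrs_comm]
  exact ⟨h.1.symm, h.2⟩

theorem mem_lightNbrs {u v : V} : v ∈ lightNbrs H u ↔ IsLight H u v := by
  simp [lightNbrs]

theorem mem_rootedCenters {τ : Fin 3 → V} {b : V} : b ∈ rootedCenters H τ ↔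
    (∀ i, IsLight H b (τ i)) ∧
      ∀ i j, i ≠ j → ∀ c, H.Adj b c → H.Adj (τ i) c → ¬ H.Adj (τ j) c := by
  simp [rootedCenters]

theorem card_filter_not_adj_of_cliqueFree {α : Type*} [Fintype α] [DecidableEq α]
    (K : SimpleGraph α) [DecidableRel K.Adj] {r : ℕ} (hr : 0 < r) (hK : K.CliqueFree (r + 1)) :
    Fintype.card α ^ 2 ≤
      r * (Finset.univ.filter fun p : α × α => ¬ K.Adj p.1 p.2).card := by
  have h1 : (Finset.univ.filter fun p : α × α => K.Adj p.1 p.2).card = 2 * K.edgeFinset.card := by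
    rw [← K.sum_degrees_eq_twice_card_edges, Finset.card_filter, Fintype.sum_prod_type]
    refine Finset.sum_congr rfl fun v _ => ?_
    rw [← Finset.card_filter, ← SimpleGraph.card_neighborFinset_eq_degree,
      SimpleGraph.neighborFinset_eq_filter]
  have h2 := Finset.card_filter_add_card_filter_not (s := (Finset.univ : Finset (α × α)))
    (fun p => K.Adj p.1 p.2)
  rw [Finset.card_univ, Fintype.card_prod, h1] at h2
  have h3 : K.edgeFinset.card ≤ (SimpleGraph.turanGraph (Fintype.card α) r).edgeFinset.card := by
    rw [SimpleGraph.card_edgeFinset_turanGraph]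
    simpa using hK.card_edgeFinset_le
  have h4 := SimpleGraph.mul_card_edgeFinset_turanGraph_le (n := Fintype.card α) (r := r)
  obtain ⟨s, rfl⟩ : ∃ s, r = s + 1 := ⟨r - 1, by omega⟩
  simp only [Nat.add_sub_cancel] at h4
  nlinarith

theorem containsCopy_of_heavy_clique (htf : ∀ u v w, H.Adj u v → H.Adj v w → ¬ H.Adj u w)
    {t : Fin 28 → V} (ht : Function.Injective t)
    (hheavy : ∀ i j, i ≠ j → 75 ≤ (commonNbrs H (t i) (t j)).card) :
    ContainsCopy H KsubThreeTwentyFive := by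
  let a : Fin 3 → V := fun i => t (Fin.castLE (by norm_num) i)
  let b : Fin 25 → V := fun j => t (Fin.natAdd 3 j)
  have hne : ∀ (i : Fin 3) (j : Fin 25),
      (Fin.castLE (by norm_num) i : Fin 28) ≠ Fin.natAdd 3 j := by
    intro i j h
    have := congrArg Fin.val h
    simp at this
    omega
  obtain ⟨c, hc, hmem⟩ := (Finset.all_card_le_biUnion_card_iff_exists_injective
    fun p : Fin 3 × Fin 25 => commonNbrs H (a p.1) (b p.2)).1 (by
      intro s
      obtain rfl | ⟨p, hp⟩ := s.eq_empty_or_nonempty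
      · simp
      · calc s.card ≤ 75 := (Finset.card_le_univ s).trans (by simp)
          _ ≤ _ := hheavy _ _ (hne p.1 p.2)
          _ ≤ _ := Finset.card_le_card (Finset.subset_biUnion_of_mem
            (fun p : Fin 3 × Fin 25 => commonNbrs H (a p.1) (b p.2)) hp))
  refine containsCopy_of_paths htf (a := a) (b := b) (c := c) ?_ ?_ hc
    (fun i j h => hne i j (ht h)) (fun p => (mem_commonNbrs.1 (hmem p)).1)
    (fun p => (mem_commonNbrs.1 (hmem p)).2)
  · exact ht.comp (Fin.castLE_injective _)
  · exact ht.comp (Fin.natAdd_injective _ _)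

theorem sq_card_le_lightPairs (htf : ∀ u v w, H.Adj u v → H.Adj v w → ¬ H.Adj u w)
    (hH : ¬ ContainsCopy H KsubThreeTwentyFive) {B : Finset V} {c : V}
    (hB : B ⊆ H.neighborFinset c) :
    B.card ^ 2 ≤ 27 * ((lightPairs H B).card + B.card) := by
  let K : SimpleGraph B :=
    { Adj := fun u v => u ≠ v ∧ 75 ≤ (commonNbrs H u v).card
      symm := ⟨fun u v h => ⟨h.1.symm, by rw [commonNbrs_comm]; exact h.2⟩⟩
      loopless := ⟨fun u h => h.1 rfl⟩ }
  have : DecidableRel K.Adj := fun _ _ => inferInstanceAs (Decidable (_ ∧ _))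
  have hK : K.CliqueFree (27 + 1) := by
    rw [SimpleGraph.cliqueFree_iff]
    refine ⟨fun f => hH ?_⟩
    refine containsCopy_of_heavy_clique htf (t := fun i => (f i : V))
      (Subtype.val_injective.comp f.injective) fun i j hij => ?_
    have : K.Adj (f i) (f j) := f.toHom.map_adj (by simpa using hij)
    exact this.2
  have h := card_filter_not_adj_of_cliqueFree K (by norm_num) hK
  rw [Fintype.card_coe] at h
  refine h.trans (Nat.mul_le_mul_left _ ?_)
  have hsub : ((Finset.univ.filter fun p : B × B => ¬ K.Adj p.1 p.2).image
      fun p => ((p.1 : V), (p.2 : V))) ⊆ lightPairs H B ∪ B.image fun v => (v, v) := by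
    intro q hq
    simp only [Finset.mem_image, Finset.mem_filter, Finset.mem_univ, true_and] at hq
    obtain ⟨⟨⟨u, hu⟩, ⟨v, hv⟩⟩, hp, rfl⟩ := hq
    simp only [Finset.mem_union, Finset.mem_image, lightPairs, Finset.mem_filter,
      Finset.mem_product, Prod.mk.injEq]
    by_cases huv : u = v
    · exact Or.inr ⟨u, hu, rfl, huv⟩
    · refine Or.inl ⟨⟨hu, hv⟩, huv, ⟨c, ?_⟩, ?_⟩
      · have h1 := hB hu
        have h2 := hB hv
        rw [SimpleGraph.mem_neighborFinset] at h1 h2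
        exact mem_commonNbrs.2 ⟨h1.symm, h2.symm⟩
      · by_contra hlt
        exact hp ⟨by simpa using huv, Nat.lt_of_not_le hlt⟩
  calc _ = _ := (Finset.card_image_of_injective _ (by
        rintro ⟨u, v⟩ ⟨u', v'⟩ h
        simp only [Prod.mk.injEq] at h
        exact Prod.ext (Subtype.ext h.1) (Subtype.ext h.2))).symm
    _ ≤ _ := Finset.card_le_card hsub
    _ ≤ _ := Finset.card_union_le _ _
    _ ≤ _ := Nat.add_le_add_left Finset.card_image_le _

theorem card_lightNbrs_le {D : ℕ} (hD : ∀ v, (H.neighborFinset v).card ≤ D) (b : V) :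
    (lightNbrs H b).card ≤ D ^ 2 := by
  have hsub : lightNbrs H b ⊆ (H.neighborFinset b).biUnion fun c => H.neighborFinset c := by
    intro a ha
    obtain ⟨c, hc⟩ := (mem_lightNbrs.1 ha).2.1
    rw [mem_commonNbrs] at hc
    simp only [Finset.mem_biUnion, SimpleGraph.mem_neighborFinset]
    exact ⟨c, hc.1, hc.2.symm⟩
  calc _ ≤ _ := Finset.card_le_card hsub
    _ ≤ (H.neighborFinset b).card * D := Finset.card_biUnion_le_card_mul _ _ _ fun c _ => hD c
    _ ≤ D ^ 2 := by rw [sq]; exact Nat.mul_le_mul_right _ (hD b)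

theorem mem_lightPairs {B : Finset V} {p : V × V} :
    p ∈ lightPairs H B ↔ (p.1 ∈ B ∧ p.2 ∈ B) ∧ IsLight H p.1 p.2 := by
  simp [lightPairs]

theorem sum_card_lightPairs_neighborFinset_le :
    ∑ c, (lightPairs H (H.neighborFinset c)).card ≤ 74 * ∑ b, (lightNbrs H b).card := by
  have h1 : ∑ c, (lightPairs H (H.neighborFinset c)).card =
      ∑ p ∈ lightPairs H Finset.univ, (commonNbrs H p.1 p.2).card := by
    simp only [Finset.card_eq_sum_ones]
    refine Finset.sum_comm' fun c p => ?_
    simp [mem_lightPairs, mem_commonNbrs, H.adj_comm c]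
  have h2 : (lightPairs H Finset.univ).card = ∑ b, (lightNbrs H b).card := by
    rw [lightPairs, Finset.univ_product_univ, Finset.card_filter, Fintype.sum_prod_type]
    simp only [lightNbrs, Finset.card_filter]
  rw [h1, ← h2, mul_comm]
  exact Finset.sum_le_card_nsmul _ _ _ fun p hp => (mem_lightPairs.1 hp).2.2.2

theorem sum_sq_degree_le (htf : ∀ u v w, H.Adj u v → H.Adj v w → ¬ H.Adj u w)
    (hH : ¬ ContainsCopy H KsubThreeTwentyFive) :
    ∑ c, (H.neighborFinset c).card ^ 2 ≤
      27 * (74 * ∑ b, (lightNbrs H b).card + ∑ c, (H.neighborFinset c).card) := by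
  calc _ ≤ ∑ c, 27 * ((lightPairs H (H.neighborFinset c)).card + (H.neighborFinset c).card) :=
        Finset.sum_le_sum fun c _ => sq_card_le_lightPairs htf hH (Finset.Subset.refl _)
    _ = 27 * (∑ c, (lightPairs H (H.neighborFinset c)).card
          + ∑ c, (H.neighborFinset c).card) := by
        rw [← Finset.mul_sum, Finset.sum_add_distrib]
    _ ≤ _ := by gcongr; exact sum_card_lightPairs_neighborFinset_le

theorem lightNbrs_cube_le {D : ℕ} (hD : ∀ v, (H.neighborFinset v).card ≤ D) (b : V) :
    (lightNbrs H b).card ^ 3 ≤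
      (Finset.univ.filter fun τ : Fin 3 → V => b ∈ rootedCenters H τ).card + 3 * D ^ 5 := by
  let E : Fin 3 → V → Finset (Fin 3 → V) := fun k c =>
    Fintype.piFinset fun l => if l = k then lightNbrs H b else H.neighborFinset c
  have hE : ∀ k c, (E k c).card ≤ D ^ 4 := by
    intro k c
    rw [Fintype.card_piFinset, ← Finset.mul_prod_erase _ _ (Finset.mem_univ k)]
    have h1 : ∏ l ∈ Finset.univ.erase k,
        (if l = k then lightNbrs H b else H.neighborFinset c).card ≤ D ^ 2 := by
      refine (Finset.prod_le_pow_card _ _ D fun l hl => ?_).trans ?_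
      · rw [if_neg (Finset.ne_of_mem_erase hl)]
        exact hD c
      · simp
    rw [if_pos rfl]
    calc _ ≤ D ^ 2 * D ^ 2 := Nat.mul_le_mul (card_lightNbrs_le hD b) h1
      _ = D ^ 4 := by ring
  have hsub : Fintype.piFinset (fun _ : Fin 3 => lightNbrs H b) ⊆
      (Finset.univ.filter fun τ : Fin 3 → V => b ∈ rootedCenters H τ) ∪
        Finset.univ.biUnion fun k : Fin 3 => (H.neighborFinset b).biUnion fun c => E k c := by
    intro τ hτ
    rw [Fintype.mem_piFinset] at hτ
    simp only [Finset.mem_union, Finset.mem_filter, Finset.mem_univ, true_and,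
      Finset.mem_biUnion, SimpleGraph.mem_neighborFinset, mem_rootedCenters]
    by_cases h : ∀ i j, i ≠ j → ∀ c, H.Adj b c → H.Adj (τ i) c → ¬ H.Adj (τ j) c
    · exact Or.inl ⟨fun i => mem_lightNbrs.1 (hτ i), h⟩
    · push Not at h
      obtain ⟨i, j, hij, c, hbc, hi, hj⟩ := h
      have hthird : ∀ i j : Fin 3, i ≠ j → ∃ k, ∀ l, l ≠ k → l = i ∨ l = j := by decide
      obtain ⟨k, hk⟩ := hthird i j hij
      refine Or.inr ⟨k, c, hbc, ?_⟩
      simp only [E, Fintype.mem_piFinset]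
      intro l
      split_ifs with hl
      · exact hτ l
      · rw [SimpleGraph.mem_neighborFinset]
        rcases hk l hl with rfl | rfl
        · exact hi.symm
        · exact hj.symm
  calc _ = (Fintype.piFinset (fun _ : Fin 3 => lightNbrs H b)).card := by simp
    _ ≤ _ := Finset.card_le_card hsub
    _ ≤ _ := Finset.card_union_le _ _
    _ ≤ _ := by
      refine Nat.add_le_add_left ?_ _
      calc _ ≤ (Finset.univ : Finset (Fin 3)).card * (D * D ^ 4) :=
            Finset.card_biUnion_le_card_mul _ _ _ fun k _ =>
              (Finset.card_biUnion_le_card_mul _ _ _ fun c _ => hE k c).trans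
                (Nat.mul_le_mul_right _ (hD b))
        _ = 3 * D ^ 5 := by simp; ring

theorem sum_lightNbrs_cube_le {D : ℕ} (hD : ∀ v, (H.neighborFinset v).card ≤ D) :
    ∑ b, (lightNbrs H b).card ^ 3 ≤
      ∑ τ, (rootedCenters H τ).card + Fintype.card V * (3 * D ^ 5) := by
  have h1 : ∑ τ, (rootedCenters H τ).card =
      ∑ b, (Finset.univ.filter fun τ : Fin 3 → V => b ∈ rootedCenters H τ).card := by
    simp only [Finset.card_eq_sum_ones]
    exact Finset.sum_comm' fun τ b => by simp
  calc _ ≤ _ := Finset.sum_le_sum fun b _ => lightNbrs_cube_le hD b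
    _ = _ := by rw [Finset.sum_add_distrib, h1]; simp

theorem card_le_of_no_shared_centers (htf : ∀ u v w, H.Adj u v → H.Adj v w → ¬ H.Adj u w)
    (hH : ¬ ContainsCopy H KsubThreeTwentyFive) (τ : Fin 3 → V) {Y : Finset V}
    (hY : Y ⊆ rootedCenters H τ)
    (hconf : ∀ y ∈ Y, ∀ y' ∈ Y, y ≠ y' → ∀ i c, H.Adj y c → H.Adj y' c → ¬ H.Adj (τ i) c) :
    Y.card ≤ 24 := by
  by_contra! hlt
  obtain ⟨Z, hZY, hZ⟩ := Finset.exists_subset_card_eq (show 25 ≤ Y.card from hlt)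
  let e := Z.equivFinOfCardEq hZ
  let b : Fin 25 → V := fun j => (e.symm j : V)
  have hb : Function.Injective b := Subtype.val_injective.comp e.symm.injective
  have hbY : ∀ j, b j ∈ Y := fun j => hZY (e.symm j).2
  have hroot : ∀ j, b j ∈ rootedCenters H τ := fun j => hY (hbY j)
  have hex : ∀ p : Fin 3 × Fin 25, ∃ c, H.Adj (b p.2) c ∧ H.Adj (τ p.1) c := fun p => by
    obtain ⟨c, hc⟩ := ((mem_rootedCenters.1 (hroot p.2)).1 p.1).2.1
    exact ⟨c, mem_commonNbrs.1 hc⟩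
  choose c hbc hac using hex
  have hsep := fun j => (mem_rootedCenters.1 (hroot j)).2
  refine hH (containsCopy_of_paths htf (a := τ) (b := b) (c := c) ?_ hb ?_ ?_ hac hbc)
  · intro i i' h
    by_contra hne
    exact hsep 0 i i' hne (c (i, 0)) (hbc (i, 0)) (hac (i, 0)) (h ▸ hac (i, 0))
  · rintro ⟨i, j⟩ ⟨i', j'⟩ h
    have hj : j = j' := by
      by_contra hne
      exact hconf (b j) (hbY j) (b j') (hbY j') (fun h' => hne (hb h')) i (c (i, j))
        (hbc (i, j)) (h ▸ hbc (i', j')) (hac (i, j))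
    subst hj
    have hi : i = i' := by
      by_contra hne
      exact hsep j i i' hne (c (i, j)) (hbc (i, j)) (hac (i, j)) (h ▸ hac (i', j))
    rw [hi]
  · intro i j h
    exact ((mem_rootedCenters.1 (hroot j)).1 i).1 h.symm

theorem exists_finset_card_max {α : Type*} [Fintype α] (P : Finset α → Prop) {Y₀ : Finset α}
    (h₀ : P Y₀) : ∃ Y, P Y ∧ ∀ Y', P Y' → Y'.card ≤ Y.card := by
  classical
  obtain ⟨Y, hY, hmax⟩ := (Finset.univ.filter P).exists_max_image Finset.card ⟨Y₀, by simpa⟩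
  exact ⟨Y, by simpa using hY, fun Y' h => hmax Y' (by simpa)⟩

theorem exists_cover_rootedCenters (htf : ∀ u v w, H.Adj u v → H.Adj v w → ¬ H.Adj u w)
    (hH : ¬ ContainsCopy H KsubThreeTwentyFive) (τ : Fin 3 → V) :
    ∃ P : Finset (Fin 3 × V), P.card ≤ 5328 ∧ (∀ p ∈ P, H.Adj (τ p.1) p.2) ∧
      ∀ b ∈ rootedCenters H τ, ∃ p ∈ P, H.Adj b p.2 := by
  obtain ⟨Y, ⟨hYS, hYc⟩, hmax⟩ := exists_finset_card_max
    (fun Y : Finset V => Y ⊆ rootedCenters H τ ∧ ∀ y ∈ Y, ∀ y' ∈ Y, y ≠ y' →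
      ∀ i c, H.Adj y c → H.Adj y' c → ¬ H.Adj (τ i) c) (Y₀ := ∅) (by simp)
  have hcard := card_le_of_no_shared_centers htf hH τ hYS hYc
  refine ⟨Finset.univ.biUnion fun i => Y.biUnion fun y =>
    (commonNbrs H y (τ i)).image fun c => (i, c), ?_, ?_, ?_⟩
  · calc _ ≤ (Finset.univ : Finset (Fin 3)).card * (24 * 74) :=
          Finset.card_biUnion_le_card_mul _ _ _ fun i _ =>
            (Finset.card_biUnion_le_card_mul _ _ _ fun y hy => Finset.card_image_le.trans
              ((mem_rootedCenters.1 (hYS hy)).1 i).2.2).trans (Nat.mul_le_mul_right _ hcard)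
      _ = 5328 := by simp
  · intro p hp
    simp only [Finset.mem_biUnion, Finset.mem_image, mem_commonNbrs] at hp
    obtain ⟨i, -, y, -, c, hc, rfl⟩ := hp
    exact hc.2
  · intro b hb
    by_contra! hno
    have hno' : ∀ i, ∀ y ∈ Y, ∀ c, H.Adj y c → H.Adj b c → ¬ H.Adj (τ i) c := by
      intro i y hy c hyc hbc hic
      refine hno (i, c) ?_ hbc
      simp only [Finset.mem_biUnion, Finset.mem_image, mem_commonNbrs]
      exact ⟨i, Finset.mem_univ _, y, hy, c, ⟨hyc, hic⟩, rfl⟩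
    have hbY : b ∉ Y := by
      intro hbY
      obtain ⟨c, hc⟩ := ((mem_rootedCenters.1 hb).1 0).2.1
      rw [mem_commonNbrs] at hc
      exact hno' 0 b hbY c hc.1 hc.1 hc.2
    have hle := hmax (insert b Y) <| by
      refine ⟨Finset.insert_subset hb hYS, ?_⟩
      intro y hy y' hy' hne i c h1 h2
      rcases Finset.mem_insert.1 hy with rfl | hyY
      · rcases Finset.mem_insert.1 hy' with rfl | hyY'
        · exact absurd rfl hne
        · exact hno' i y' hyY' c h2 h1
      · rcases Finset.mem_insert.1 hy' with rfl | hyY'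
        · exact hno' i y hyY c h1 h2
        · exact hYc y hyY y' hyY' hne i c h1 h2
    rw [Finset.card_insert_of_notMem hbY] at hle
    omega

theorem card_rootedCenters_le (htf : ∀ u v w, H.Adj u v → H.Adj v w → ¬ H.Adj u w)
    (hH : ¬ ContainsCopy H KsubThreeTwentyFive) {D : ℕ}
    (hD : ∀ v, (H.neighborFinset v).card ≤ D) (τ : Fin 3 → V) :
    (rootedCenters H τ).card ≤ 5328 * D := by
  obtain ⟨P, hP, -, hcov⟩ := exists_cover_rootedCenters htf hH τ
  have hsub : rootedCenters H τ ⊆ P.biUnion fun p => H.neighborFinset p.2 := by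
    intro b hb
    obtain ⟨p, hp, hbp⟩ := hcov b hb
    simp only [Finset.mem_biUnion, SimpleGraph.mem_neighborFinset]
    exact ⟨p, hp, hbp.symm⟩
  calc _ ≤ _ := Finset.card_le_card hsub
    _ ≤ P.card * D := Finset.card_biUnion_le_card_mul _ _ _ fun p _ => hD _
    _ ≤ _ := Nat.mul_le_mul_right _ hP

theorem card_light_to_triple_le (htf : ∀ u v w, H.Adj u v → H.Adj v w → ¬ H.Adj u w)
    (hH : ¬ ContainsCopy H KsubThreeTwentyFive) {D : ℕ}
    (hD : ∀ v, (H.neighborFinset v).card ≤ D) (τ : Fin 3 → V)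
    (hτ : ∀ i j, i ≠ j → IsLight H (τ i) (τ j)) :
    (Finset.univ.filter fun a => ∀ i, IsLight H a (τ i)).card ≤ 5550 * D := by
  let Q : Finset (Fin 3 × Fin 3) := Finset.univ.filter fun q => q.1 < q.2
  have hQ : Q.card = 3 := by decide
  have hsub : (Finset.univ.filter fun a => ∀ i, IsLight H a (τ i)) ⊆ rootedCenters H τ ∪
      Q.biUnion fun q => (commonNbrs H (τ q.1) (τ q.2)).biUnion fun c => H.neighborFinset c := by
    intro a ha
    simp only [Finset.mem_filter, Finset.mem_univ, true_and] at ha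
    simp only [Finset.mem_union, Finset.mem_biUnion, mem_commonNbrs,
      SimpleGraph.mem_neighborFinset, mem_rootedCenters, Q, Finset.mem_filter, Finset.mem_univ,
      true_and]
    by_cases h : ∀ i j, i ≠ j → ∀ c, H.Adj a c → H.Adj (τ i) c → ¬ H.Adj (τ j) c
    · exact Or.inl ⟨ha, h⟩
    · push Not at h
      obtain ⟨i, j, hij, c, hac, hi, hj⟩ := h
      rcases lt_or_gt_of_ne hij with hlt | hlt
      · exact Or.inr ⟨(i, j), hlt, c, ⟨hi, hj⟩, hac.symm⟩
      · exact Or.inr ⟨(j, i), hlt, c, ⟨hj, hi⟩, hac.symm⟩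
  calc _ ≤ _ := Finset.card_le_card hsub
    _ ≤ _ := Finset.card_union_le _ _
    _ ≤ 5328 * D + Q.card * (74 * D) := by
      refine Nat.add_le_add (card_rootedCenters_le htf hH hD τ)
        (Finset.card_biUnion_le_card_mul _ _ _ fun q hq => ?_)
      refine (Finset.card_biUnion_le_card_mul _ _ _ fun c _ => hD c).trans
        (Nat.mul_le_mul_right _ ?_)
      exact (hτ _ _ (Finset.mem_filter.1 hq).2.ne).2.2
    _ = 5550 * D := by rw [hQ]; ring

theorem sum_card_rootedCenters_inter_neighborFinset_le (τ : Fin 3 → V) :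
    ∑ i, ∑ c ∈ H.neighborFinset (τ i), (rootedCenters H τ ∩ H.neighborFinset c).card ≤
      222 * (rootedCenters H τ).card := by
  have h1 : ∀ i, ∑ c ∈ H.neighborFinset (τ i), (rootedCenters H τ ∩ H.neighborFinset c).card ≤
      74 * (rootedCenters H τ).card := by
    intro i
    have h2 : ∑ c ∈ H.neighborFinset (τ i), (rootedCenters H τ ∩ H.neighborFinset c).card =
        ∑ b ∈ rootedCenters H τ, (commonNbrs H b (τ i)).card := by
      simp only [Finset.card_eq_sum_ones]
      refine Finset.sum_comm' fun c b => ?_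
      simp only [SimpleGraph.mem_neighborFinset, Finset.mem_inter, mem_commonNbrs, H.adj_comm c]
      tauto
    rw [h2, mul_comm]
    exact Finset.sum_le_card_nsmul _ _ _ fun b hb => ((mem_rootedCenters.1 hb).1 i).2.2
  calc _ ≤ ∑ _i : Fin 3, 74 * (rootedCenters H τ).card := Finset.sum_le_sum fun i _ => h1 i
    _ = _ := by simp; ring

theorem sq_card_rootedCenters_le (htf : ∀ u v w, H.Adj u v → H.Adj v w → ¬ H.Adj u w)
    (hH : ¬ ContainsCopy H KsubThreeTwentyFive) (τ : Fin 3 → V) :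
    (rootedCenters H τ).card ^ 2 ≤ 143856 * (∑ i, ∑ c ∈ H.neighborFinset (τ i),
      (lightPairs H (rootedCenters H τ ∩ H.neighborFinset c)).card +
        222 * (rootedCenters H τ).card) := by
  obtain ⟨P, hP, hPadj, hcov⟩ := exists_cover_rootedCenters htf hH τ
  set S := rootedCenters H τ
  have h1 : S.card ≤ ∑ p ∈ P, (S ∩ H.neighborFinset p.2).card := by
    refine (Finset.card_le_card fun b hb => ?_).trans Finset.card_biUnion_le
    obtain ⟨p, hp, hbp⟩ := hcov b hb
    simp only [Finset.mem_biUnion, Finset.mem_inter, SimpleGraph.mem_neighborFinset]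
    exact ⟨p, hp, hb, hbp.symm⟩
  have hPsub : P ⊆ (Finset.univ.sigma fun i => H.neighborFinset (τ i)).image
      fun q : (_ : Fin 3) × V => (q.1, q.2) := by
    rintro ⟨i, c⟩ hp
    simp only [Finset.mem_image, Finset.mem_sigma, Finset.mem_univ, true_and,
      SimpleGraph.mem_neighborFinset]
    exact ⟨⟨i, c⟩, hPadj _ hp, rfl⟩
  have h2 : ∑ p ∈ P, (S ∩ H.neighborFinset p.2).card ^ 2 ≤
      ∑ i, ∑ c ∈ H.neighborFinset (τ i), (S ∩ H.neighborFinset c).card ^ 2 := by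
    refine (Finset.sum_le_sum_of_subset hPsub).trans ?_
    rw [Finset.sum_image (by rintro ⟨i, c⟩ _ ⟨i', c'⟩ _ h; simp at h; obtain ⟨rfl, rfl⟩ := h; rfl),
      Finset.sum_sigma]
  calc S.card ^ 2 ≤ (∑ p ∈ P, (S ∩ H.neighborFinset p.2).card) ^ 2 := Nat.pow_le_pow_left h1 2
    _ ≤ P.card * ∑ p ∈ P, (S ∩ H.neighborFinset p.2).card ^ 2 := sq_sum_le_card_mul_sum_sq
    _ ≤ 5328 * ∑ i, ∑ c ∈ H.neighborFinset (τ i), (S ∩ H.neighborFinset c).card ^ 2 :=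
        Nat.mul_le_mul hP h2
    _ ≤ 5328 * ∑ i, ∑ c ∈ H.neighborFinset (τ i),
          27 * ((lightPairs H (S ∩ H.neighborFinset c)).card + (S ∩ H.neighborFinset c).card) := by
        gcongr
        exact sq_card_le_lightPairs htf hH Finset.inter_subset_right
    _ = 143856 * (∑ i, ∑ c ∈ H.neighborFinset (τ i),
          (lightPairs H (S ∩ H.neighborFinset c)).card +
          ∑ i, ∑ c ∈ H.neighborFinset (τ i), (S ∩ H.neighborFinset c).card) := by
        simp only [← Finset.mul_sum, Finset.sum_add_distrib]
        ring
    _ ≤ _ := by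
        gcongr
        exact sum_card_rootedCenters_inter_neighborFinset_le τ

theorem sum_lightPairs_rootedCenters_le {D : ℕ} (hD : ∀ v, (H.neighborFinset v).card ≤ D) :
    ∑ τ : Fin 3 → V, ∑ i, ∑ c ∈ H.neighborFinset (τ i),
        (lightPairs H (rootedCenters H τ ∩ H.neighborFinset c)).card ≤
      3 * D * ∑ c, ∑ p ∈ lightPairs H (H.neighborFinset c),
        (lightNbrs H p.1 ∩ lightNbrs H p.2).card ^ 2 := by
  have h1 : ∀ i : Fin 3, ∑ τ : Fin 3 → V, ∑ c ∈ H.neighborFinset (τ i),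
      (lightPairs H (rootedCenters H τ ∩ H.neighborFinset c)).card ≤
      ∑ c, ∑ p ∈ lightPairs H (H.neighborFinset c),
        D * (lightNbrs H p.1 ∩ lightNbrs H p.2).card ^ 2 := by
    intro i
    have h2 : ∑ τ : Fin 3 → V, ∑ c ∈ H.neighborFinset (τ i),
        (lightPairs H (rootedCenters H τ ∩ H.neighborFinset c)).card =
        ∑ c, ∑ τ ∈ Finset.univ.filter (fun τ : Fin 3 → V => H.Adj (τ i) c),
          (lightPairs H (rootedCenters H τ ∩ H.neighborFinset c)).card :=
      Finset.sum_comm' fun τ c => by simp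
    rw [h2]
    refine Finset.sum_le_sum fun c _ => ?_
    have h3 : ∑ τ ∈ Finset.univ.filter (fun τ : Fin 3 → V => H.Adj (τ i) c),
          (lightPairs H (rootedCenters H τ ∩ H.neighborFinset c)).card =
        ∑ p ∈ lightPairs H (H.neighborFinset c), (Finset.univ.filter fun τ : Fin 3 → V =>
          H.Adj (τ i) c ∧ p.1 ∈ rootedCenters H τ ∧ p.2 ∈ rootedCenters H τ).card := by
      simp only [Finset.card_eq_sum_ones]
      refine Finset.sum_comm' fun τ p => ?_
      simp only [mem_lightPairs, Finset.mem_filter, Finset.mem_inter, Finset.mem_univ, true_and]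
      tauto
    rw [h3]
    refine Finset.sum_le_sum fun p _ => ?_
    let E : Finset (Fin 3 → V) := Fintype.piFinset fun l =>
      if l = i then H.neighborFinset c else lightNbrs H p.1 ∩ lightNbrs H p.2
    have hE : E.card ≤ D * (lightNbrs H p.1 ∩ lightNbrs H p.2).card ^ 2 := by
      rw [Fintype.card_piFinset, ← Finset.mul_prod_erase _ _ (Finset.mem_univ i), if_pos rfl]
      refine Nat.mul_le_mul (hD c) ((Finset.prod_le_pow_card _ _
        (lightNbrs H p.1 ∩ lightNbrs H p.2).card fun l hl => ?_).trans ?_)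
      · rw [if_neg (Finset.ne_of_mem_erase hl)]
      · simp
    refine (Finset.card_le_card fun τ hτ => ?_).trans hE
    simp only [Finset.mem_filter, Finset.mem_univ, true_and, mem_rootedCenters] at hτ
    simp only [E, Fintype.mem_piFinset]
    intro l
    split_ifs with hl
    · rw [SimpleGraph.mem_neighborFinset, hl]
      exact hτ.1.symm
    · rw [Finset.mem_inter, mem_lightNbrs, mem_lightNbrs]
      exact ⟨hτ.2.1.1 l, hτ.2.2.1 l⟩
  rw [Finset.sum_comm]
  calc _ ≤ ∑ _i : Fin 3, _ := Finset.sum_le_sum fun i _ => h1 i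
    _ = _ := by
      simp only [← Finset.mul_sum]
      simp
      ring

theorem sum_card_inter_lightNbrs_sq_le (htf : ∀ u v w, H.Adj u v → H.Adj v w → ¬ H.Adj u w)
    (hH : ¬ ContainsCopy H KsubThreeTwentyFive) {D : ℕ}
    (hD : ∀ v, (H.neighborFinset v).card ≤ D) (b c : V) {T : Finset V}
    (hT : T ⊆ H.neighborFinset c ∩ lightNbrs H b) :
    (∑ b' ∈ T, (lightNbrs H b ∩ lightNbrs H b').card) ^ 2 ≤
      D ^ 2 * (27 * (T.card ^ 2 * (5550 * D) +
        ∑ b' ∈ T, (lightNbrs H b ∩ lightNbrs H b').card)) := by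
  let B : V → Finset V := fun a => T.filter fun b' => a ∈ lightNbrs H b'
  have h1 : ∑ b' ∈ T, (lightNbrs H b ∩ lightNbrs H b').card = ∑ a ∈ lightNbrs H b, (B a).card := by
    simp only [Finset.card_eq_sum_ones]
    refine Finset.sum_comm' fun b' a => ?_
    simp only [B, Finset.mem_inter, Finset.mem_filter]
    tauto
  have h2 : ∑ a ∈ lightNbrs H b, (lightPairs H (B a)).card ≤ T.card ^ 2 * (5550 * D) := by
    have h3 : ∑ a ∈ lightNbrs H b, (lightPairs H (B a)).card = ∑ p ∈ lightPairs H T,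
        ((lightNbrs H b).filter fun a => a ∈ lightNbrs H p.1 ∧ a ∈ lightNbrs H p.2).card := by
      simp only [Finset.card_eq_sum_ones]
      refine Finset.sum_comm' fun a p => ?_
      simp only [mem_lightPairs, Finset.mem_filter, B]
      tauto
    have h4 : (lightPairs H T).card ≤ T.card ^ 2 := by
      rw [sq, ← Finset.card_product]
      exact Finset.card_filter_le _ _
    rw [h3]
    refine (Finset.sum_le_card_nsmul _ _ (5550 * D) fun p hp => ?_).trans
      (Nat.mul_le_mul_right _ h4)
    obtain ⟨⟨hp1, hp2⟩, hp12⟩ := mem_lightPairs.1 hp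
    have hb1 := mem_lightNbrs.1 (Finset.mem_inter.1 (hT hp1)).2
    have hb2 := mem_lightNbrs.1 (Finset.mem_inter.1 (hT hp2)).2
    refine (Finset.card_le_card fun a ha => ?_).trans
      (card_light_to_triple_le htf hH hD ![b, p.1, p.2] ?_)
    · simp only [Finset.mem_filter, mem_lightNbrs, Finset.mem_univ, true_and] at ha ⊢
      intro i
      fin_cases i
      · exact ha.1.symm
      · exact ha.2.1.symm
      · exact ha.2.2.symm
    · intro i j hij
      fin_cases i <;> fin_cases j
      · exact absurd rfl hij
      · exact hb1
      · exact hb2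
      · exact hb1.symm
      · exact absurd rfl hij
      · exact hp12
      · exact hb2.symm
      · exact hp12.symm
      · exact absurd rfl hij
  calc _ = (∑ a ∈ lightNbrs H b, (B a).card) ^ 2 := by rw [h1]
    _ ≤ (lightNbrs H b).card * ∑ a ∈ lightNbrs H b, (B a).card ^ 2 := sq_sum_le_card_mul_sum_sq
    _ ≤ D ^ 2 * ∑ a ∈ lightNbrs H b, 27 * ((lightPairs H (B a)).card + (B a).card) := by
        refine Nat.mul_le_mul (card_lightNbrs_le hD b) (Finset.sum_le_sum fun a _ => ?_)
        exact sq_card_le_lightPairs htf hH (c := c)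
          (((Finset.filter_subset _ _).trans hT).trans Finset.inter_subset_left)
    _ = D ^ 2 * (27 * (∑ a ∈ lightNbrs H b, (lightPairs H (B a)).card +
          ∑ a ∈ lightNbrs H b, (B a).card)) := by
        rw [← Finset.mul_sum, Finset.sum_add_distrib]
    _ ≤ _ := by
        rw [← h1]
        gcongr

theorem sum_sq_card_inter_lightNbrs_le (htf : ∀ u v w, H.Adj u v → H.Adj v w → ¬ H.Adj u w)
    (hH : ¬ ContainsCopy H KsubThreeTwentyFive) {D : ℕ}
    (hD : ∀ v, (H.neighborFinset v).card ≤ D) (b c : V) :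
    ∑ b' ∈ H.neighborFinset c ∩ lightNbrs H b, (lightNbrs H b ∩ lightNbrs H b').card ^ 2 ≤
      299754 * D ^ 4 := by
  set x : V → ℕ := fun b' => (lightNbrs H b ∩ lightNbrs H b').card with hx
  have hxD : ∀ b', x b' ≤ D ^ 2 := fun b' =>
    (Finset.card_le_card Finset.inter_subset_left).trans (card_lightNbrs_le hD b)
  set U := H.neighborFinset c ∩ lightNbrs H b with hU
  set T := U.filter fun b' => 299700 * D ^ 3 < x b' ^ 2 with hT
  have hX := sum_card_inter_lightNbrs_sq_le htf hH hD b c (T := T) (Finset.filter_subset _ _)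
  change (∑ b' ∈ T, x b') ^ 2 ≤ D ^ 2 * (27 * (T.card ^ 2 * (5550 * D) + ∑ b' ∈ T, x b')) at hX
  have hXle : ∑ b' ∈ T, x b' ≤ 54 * D ^ 2 := by
    obtain hTe | hTne := T.eq_empty_or_nonempty
    · simp [hTe]
    · obtain ⟨b₀, hb₀, hmin⟩ := T.exists_min_image x hTne
      have h1 : T.card * x b₀ ≤ ∑ b' ∈ T, x b' := by
        simpa using Finset.card_nsmul_le_sum T x (x b₀) hmin
      have h2 : 299700 * D ^ 3 < x b₀ ^ 2 := (Finset.mem_filter.1 hb₀).2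
      have h3 : T.card ^ 2 * (299700 * D ^ 3) ≤ (∑ b' ∈ T, x b') ^ 2 := by
        calc _ ≤ T.card ^ 2 * x b₀ ^ 2 := Nat.mul_le_mul_left _ h2.le
          _ = (T.card * x b₀) ^ 2 := by ring
          _ ≤ _ := Nat.pow_le_pow_left h1 2
      by_contra! hlt
      nlinarith
  have hTsum : ∑ b' ∈ T, x b' ^ 2 ≤ 54 * D ^ 4 := by
    calc ∑ b' ∈ T, x b' ^ 2 ≤ ∑ b' ∈ T, D ^ 2 * x b' := Finset.sum_le_sum fun b' _ => by
          rw [sq]; exact Nat.mul_le_mul_right _ (hxD b')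
      _ = D ^ 2 * ∑ b' ∈ T, x b' := by rw [Finset.mul_sum]
      _ ≤ D ^ 2 * (54 * D ^ 2) := Nat.mul_le_mul_left _ hXle
      _ = _ := by ring
  have hUcard : U.card ≤ D := (Finset.card_le_card Finset.inter_subset_left).trans (hD c)
  have hrest : ∑ b' ∈ U.filter (fun b' => ¬ 299700 * D ^ 3 < x b' ^ 2), x b' ^ 2 ≤
      299700 * D ^ 4 := by
    calc _ ≤ (U.filter (fun b' => ¬ 299700 * D ^ 3 < x b' ^ 2)).card * (299700 * D ^ 3) :=
          Finset.sum_le_card_nsmul _ _ _ fun b' hb' => not_lt.1 (Finset.mem_filter.1 hb').2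
      _ ≤ D * (299700 * D ^ 3) :=
          Nat.mul_le_mul_right _ ((Finset.card_filter_le _ _).trans hUcard)
      _ = _ := by ring
  rw [← Finset.sum_filter_add_sum_filter_not U (fun b' => 299700 * D ^ 3 < x b' ^ 2)]
  calc _ ≤ 54 * D ^ 4 + 299700 * D ^ 4 := Nat.add_le_add hTsum hrest
    _ = _ := by ring

theorem sum_sum_sq_card_inter_lightNbrs_le
    (htf : ∀ u v w, H.Adj u v → H.Adj v w → ¬ H.Adj u w)
    (hH : ¬ ContainsCopy H KsubThreeTwentyFive) {D : ℕ}
    (hD : ∀ v, (H.neighborFinset v).card ≤ D) :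
    ∑ c, ∑ p ∈ lightPairs H (H.neighborFinset c),
      (lightNbrs H p.1 ∩ lightNbrs H p.2).card ^ 2 ≤ Fintype.card V * (299754 * D ^ 5) := by
  have h1 : ∀ c, ∑ p ∈ lightPairs H (H.neighborFinset c),
      (lightNbrs H p.1 ∩ lightNbrs H p.2).card ^ 2 ≤ 299754 * D ^ 5 := by
    intro c
    have h2 : lightPairs H (H.neighborFinset c) = ((H.neighborFinset c).sigma fun b =>
        H.neighborFinset c ∩ lightNbrs H b).image fun q => (q.1, q.2) := by
      ext ⟨b, b'⟩
      simp only [mem_lightPairs, Finset.mem_image, Finset.mem_sigma, Finset.mem_inter,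
        mem_lightNbrs]
      constructor
      · rintro ⟨⟨h, h'⟩, hl⟩
        exact ⟨⟨b, b'⟩, ⟨h, h', hl⟩, rfl⟩
      · rintro ⟨⟨u, u'⟩, ⟨h, h', hl⟩, heq⟩
        obtain ⟨rfl, rfl⟩ := Prod.mk.injEq _ _ _ _ ▸ heq
        exact ⟨⟨h, h'⟩, hl⟩
    rw [h2, Finset.sum_image
      (by rintro ⟨i, c⟩ _ ⟨i', c'⟩ _ h; simp at h; obtain ⟨rfl, rfl⟩ := h; rfl), Finset.sum_sigma]
    calc _ ≤ (H.neighborFinset c).card * (299754 * D ^ 4) :=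
          Finset.sum_le_card_nsmul _ _ _ fun b _ =>
            sum_sq_card_inter_lightNbrs_le htf hH hD b c
      _ ≤ D * (299754 * D ^ 4) := Nat.mul_le_mul_right _ (hD c)
      _ = _ := by ring
  calc _ ≤ ∑ _c : V, 299754 * D ^ 5 := Finset.sum_le_sum fun c _ => h1 c
    _ = _ := by simp

theorem sum_sq_card_rootedCenters_le (htf : ∀ u v w, H.Adj u v → H.Adj v w → ¬ H.Adj u w)
    (hH : ¬ ContainsCopy H KsubThreeTwentyFive) {D : ℕ}
    (hD : ∀ v, (H.neighborFinset v).card ≤ D) :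
    ∑ τ, (rootedCenters H τ).card ^ 2 ≤ 143856 * (899262 * Fintype.card V * D ^ 6 +
      222 * ∑ τ, (rootedCenters H τ).card) := by
  calc _ ≤ ∑ τ, _ := Finset.sum_le_sum fun τ _ => sq_card_rootedCenters_le htf hH τ
    _ ≤ 143856 * (3 * D * (Fintype.card V * (299754 * D ^ 5)) +
          222 * ∑ τ, (rootedCenters H τ).card) := by
        rw [← Finset.mul_sum, Finset.sum_add_distrib, ← Finset.mul_sum]
        gcongr
        exact (sum_lightPairs_rootedCenters_le hD).trans
          (Nat.mul_le_mul_left _ (sum_sum_sq_card_inter_lightNbrs_le htf hH hD))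
    _ = _ := by ring

end Counting

theorem exists_pow_six_le (κ : ℝ) (hκ : 1 ≤ κ) : ∃ C : ℝ, 0 < C ∧
    ∀ n D s Q L L3 R R2 : ℝ, 1 ≤ n → 0 ≤ D → 0 ≤ L → n * D ≤ κ * s → s ^ 2 ≤ n * Q →
      Q ≤ 1998 * L + 27 * s → L ^ 3 ≤ n ^ 2 * L3 → L3 ≤ R + 3 * n * D ^ 5 →
      R ^ 2 ≤ n ^ 3 * R2 → R2 ≤ 143856 * (899262 * n * D ^ 6 + 222 * R) →
      D ^ 6 ≤ C * n ^ 2 := by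
  have hκ0 : 0 < κ := by linarith
  set α : ℝ := 1 / (3996 * κ ^ 2) with hα
  have hα0 : 0 < α := by positivity
  set β : ℝ := α ^ 3 / 2 with hβ
  have hβ0 : 0 < β := by positivity
  set γ : ℝ := 143856 * (899262 / β + 222) with hγ
  have hγ0 : 0 < γ := by positivity
  set M : ℝ := 54 * κ + 6 / α ^ 3 with hM
  have hM0 : 0 < M := by positivity
  refine ⟨M ^ 6 + γ / β, by positivity, ?_⟩
  intro n D s Q L L3 R R2 hn hD hL hs hsQ hQ hL3 hL3R hR hR2
  have hn0 : 0 < n := by linarith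
  by_cases hDM : D ≤ M
  · calc D ^ 6 ≤ M ^ 6 := pow_le_pow_left₀ hD hDM 6
      _ ≤ (M ^ 6 + γ / β) * 1 := by rw [mul_one]; exact le_add_of_nonneg_right (by positivity)
      _ ≤ _ := by gcongr; exact one_le_pow₀ hn
  push Not at hDM
  have hD1 : 54 * κ ≤ D := by
    have : 0 < 6 / α ^ 3 := by positivity
    linarith
  have hD2 : 6 / α ^ 3 ≤ D := by linarith
  have hD0 : 0 < D := by linarith
  have hs0 : 0 < s := by
    have : 0 < n * D := by positivity
    by_contra! h
    nlinarith
  have hQs : 54 * s ≤ Q := by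
    have h1 : n * D * s ≤ κ * (n * Q) := by nlinarith
    have h2 : D * s ≤ κ * Q := by
      have : n * (D * s) ≤ n * (κ * Q) := by linarith
      exact le_of_mul_le_mul_left this hn0
    have h3 : κ * (54 * s) ≤ κ * Q := by nlinarith
    exact le_of_mul_le_mul_left h3 hκ0
  have hQL : Q ≤ 3996 * L := by linarith
  have hLlow : α * (n * D ^ 2) ≤ L := by
    have h1 : (n * D) ^ 2 ≤ (κ * s) ^ 2 := pow_le_pow_left₀ (by positivity) hs 2
    have h2 : n * (n * D ^ 2) ≤ n * (κ ^ 2 * (3996 * L)) := by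
      calc n * (n * D ^ 2) = (n * D) ^ 2 := by ring
        _ ≤ κ ^ 2 * s ^ 2 := by rw [← mul_pow]; exact h1
        _ ≤ κ ^ 2 * (n * Q) := by gcongr
        _ ≤ κ ^ 2 * (n * (3996 * L)) := by gcongr
        _ = _ := by ring
    have h3 := le_of_mul_le_mul_left h2 hn0
    rw [hα, one_div, inv_mul_le_iff₀ (by positivity)]
    linarith
  have hL3low : α ^ 3 * (n * D ^ 6) ≤ L3 := by
    have h1 : n ^ 2 * (α ^ 3 * (n * D ^ 6)) ≤ n ^ 2 * L3 := by
      calc _ = (α * (n * D ^ 2)) ^ 3 := by ring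
        _ ≤ L ^ 3 := pow_le_pow_left₀ (by positivity) hLlow 3
        _ ≤ _ := hL3
    exact le_of_mul_le_mul_left h1 (by positivity)
  have hRlow : β * (n * D ^ 6) ≤ R := by
    have h1 : 6 ≤ D * α ^ 3 := by rwa [div_le_iff₀ (by positivity)] at hD2
    have h2 : 6 * (n * D ^ 5) ≤ D * α ^ 3 * (n * D ^ 5) := by gcongr
    have h3 : D * α ^ 3 * (n * D ^ 5) = α ^ 3 * (n * D ^ 6) := by ring
    rw [hβ]
    linarith
  have hR0 : 0 < R := lt_of_lt_of_le (by positivity) hRlow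
  have hRup : R ≤ γ * n ^ 3 := by
    have h1 : n * D ^ 6 ≤ R / β := by rw [le_div_iff₀ hβ0]; linarith
    have h2 : R * R ≤ R * (γ * n ^ 3) := by
      calc R * R = R ^ 2 := by ring
        _ ≤ n ^ 3 * R2 := hR
        _ ≤ n ^ 3 * (143856 * (899262 * (R / β) + 222 * R)) := by
          gcongr
          nlinarith
        _ = _ := by rw [hγ]; ring
    exact le_of_mul_le_mul_left h2 hR0
  have h1 : n * (β * D ^ 6) ≤ n * (γ * n ^ 2) := by
    calc _ = β * (n * D ^ 6) := by ring
      _ ≤ γ * n ^ 3 := hRlow.trans hRup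
      _ = _ := by ring
  have h2 := le_of_mul_le_mul_left h1 hn0
  calc D ^ 6 ≤ γ / β * n ^ 2 := by
        rw [div_mul_eq_mul_div, le_div_iff₀ hβ0]; linarith
    _ ≤ _ := by gcongr; exact le_add_of_nonneg_left (by positivity)

theorem exists_maxDegree_pow_six_le (κ : ℝ) (hκ : 1 ≤ κ) : ∃ C : ℝ, 0 < C ∧
    ∀ (V : Type) [Fintype V] [DecidableEq V] [Nonempty V] (H : SimpleGraph V)
      [DecidableRel H.Adj] (D : ℕ), (∀ u v w, H.Adj u v → H.Adj v w → ¬ H.Adj u w) →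
      ¬ ContainsCopy H KsubThreeTwentyFive → (∀ v, (H.neighborFinset v).card ≤ D) →
      (Fintype.card V : ℝ) * D ≤ κ * ∑ v, ((H.neighborFinset v).card : ℝ) →
      (D : ℝ) ^ 6 ≤ C * (Fintype.card V : ℝ) ^ 2 := by
  obtain ⟨C, hC, h⟩ := exists_pow_six_le κ hκ
  refine ⟨C, hC, ?_⟩
  intro V _ _ _ H _ D htf hH hD hs
  refine h _ _ _ (∑ v, ((H.neighborFinset v).card : ℝ) ^ 2) (∑ b, ((lightNbrs H b).card : ℝ))
    (∑ b, ((lightNbrs H b).card : ℝ) ^ 3) (∑ τ, ((rootedCenters H τ).card : ℝ))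
    (∑ τ, ((rootedCenters H τ).card : ℝ) ^ 2) ?_ (Nat.cast_nonneg D) (by positivity) hs ?_ ?_ ?_
    ?_ ?_ ?_
  · exact_mod_cast Fintype.card_pos
  · simpa using sq_sum_le_card_mul_sum_sq (s := Finset.univ)
      (f := fun v => ((H.neighborFinset v).card : ℝ))
  · have h1 := sum_sq_degree_le htf hH
    have h2 : (∑ c, ((H.neighborFinset c).card : ℝ) ^ 2) ≤
      27 * (74 * ∑ b, ((lightNbrs H b).card : ℝ) + ∑ c, ((H.neighborFinset c).card : ℝ)) := by
      exact_mod_cast h1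
    linarith
  · simpa using pow_sum_le_card_mul_sum_pow (s := Finset.univ)
      (f := fun b => ((lightNbrs H b).card : ℝ)) (fun b _ => Nat.cast_nonneg _) 2
  · have h1 := sum_lightNbrs_cube_le hD
    have h2 : ∑ b, ((lightNbrs H b).card : ℝ) ^ 3 ≤
      ∑ τ, ((rootedCenters H τ).card : ℝ) + Fintype.card V * (3 * (D : ℝ) ^ 5) := by
      exact_mod_cast h1
    linarith
  · simpa using sq_sum_le_card_mul_sum_sq (s := Finset.univ)
      (f := fun τ : Fin 3 → V => ((rootedCenters H τ).card : ℝ))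
  · exact_mod_cast sum_sq_card_rootedCenters_le htf hH hD

section Regularization

theorem exists_max_ratio_interedges {V : Type*} [Fintype V] [Nonempty V]
    (G : SimpleGraph V) [DecidableRel G.Adj] : ∃ U : Finset V, U.Nonempty ∧ ∀ W : Finset V,
      (G.interedges W W).card ^ 3 * U.card ^ 4 ≤ (G.interedges U U).card ^ 3 * W.card ^ 4 := by
  classical
  obtain ⟨U, hU, hmax⟩ := (Finset.univ.filter fun U : Finset V => U.Nonempty).exists_max_image
    (fun U => ((G.interedges U U).card : ℝ) ^ 3 / (U.card : ℝ) ^ 4)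
    ⟨Finset.univ, by simp [Finset.univ_nonempty]⟩
  have hU' : U.Nonempty := by simpa using hU
  refine ⟨U, hU', fun W => ?_⟩
  obtain rfl | hW := W.eq_empty_or_nonempty
  · simp [SimpleGraph.interedges, Rel.interedges]
  · have h := hmax W (by simpa using hW)
    have h1 : (0 : ℝ) < U.card := by exact_mod_cast hU'.card_pos
    have h2 : (0 : ℝ) < W.card := by exact_mod_cast hW.card_pos
    rw [div_le_div_iff₀ (by positivity) (by positivity)] at h
    exact_mod_cast h

theorem four_mul_card_interedges_le {V : Type*} [DecidableEq V]
    (G : SimpleGraph V) [DecidableRel G.Adj] {U A : Finset V} (hcard : 5184 ≤ U.card)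
    (hA : A.card * 5184 ≤ U.card)
    (hmax : ∀ W : Finset V, (G.interedges W W).card ^ 3 * U.card ^ 4 ≤
      (G.interedges U U).card ^ 3 * W.card ^ 4) :
    4 * (G.interedges A U).card ≤ (G.interedges U U).card := by
  obtain ⟨P, hP, hPcard⟩ := Finpartition.exists_equipartition_card_eq U
    (n := 5184) (by norm_num) hcard
  have hpart : ∀ B ∈ P.parts, 20736 * (G.interedges A B).card ≤ (G.interedges U U).card := by
    intro B hB
    have hBcard := hP.card_part_le_average_add_one hB
    rw [hPcard] at hBcard
    have hW : (A ∪ B).card * 5184 ≤ 3 * U.card := by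
      have := Finset.card_union_le A B
      have := Nat.div_mul_le_self U.card 5184
      calc _ ≤ (A.card + (U.card / 5184 + 1)) * 5184 := by gcongr; omega
        _ = A.card * 5184 + U.card / 5184 * 5184 + 5184 := by ring
        _ ≤ U.card + U.card + U.card := by gcongr
        _ = _ := by ring
    have hsub : (G.interedges A B).card ≤ (G.interedges (A ∪ B) (A ∪ B)).card :=
      Finset.card_le_card (SimpleGraph.interedges_mono G Finset.subset_union_left
        Finset.subset_union_right)
    have h1 := hmax (A ∪ B)
    set e := (G.interedges (A ∪ B) (A ∪ B)).card
    set E := (G.interedges U U).card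
    have h2 : (20736 * e) ^ 3 * (U.card ^ 4 * 81) ≤ E ^ 3 * (U.card ^ 4 * 81) := by
      calc (20736 * e) ^ 3 * (U.card ^ 4 * 81) = (e ^ 3 * U.card ^ 4) * 5184 ^ 4 := by ring
        _ ≤ (E ^ 3 * (A ∪ B).card ^ 4) * 5184 ^ 4 := Nat.mul_le_mul_right _ h1
        _ = E ^ 3 * ((A ∪ B).card * 5184) ^ 4 := by ring
        _ ≤ E ^ 3 * (3 * U.card) ^ 4 := Nat.mul_le_mul_left _ (Nat.pow_le_pow_left hW 4)
        _ = _ := by ring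
    have h3 := le_of_mul_le_mul_right h2 (by positivity)
    have h4 := le_of_pow_le_pow_left₀ (by norm_num) (Nat.zero_le _) h3
    omega
  have hsum : (G.interedges A U).card = ∑ B ∈ P.parts, (G.interedges A B).card :=
    Rel.card_interedges_finpartition_right _ _ _
  have h5 : ∑ B ∈ P.parts, 20736 * (G.interedges A B).card ≤
      P.parts.card * (G.interedges U U).card := Finset.sum_le_card_nsmul _ _ _ hpart
  rw [← Finset.mul_sum, ← hsum, hPcard] at h5
  omega

theorem card_interedges_eq_sum {V : Type*} [DecidableEq V]
    (G : SimpleGraph V) [DecidableRel G.Adj] (A B : Finset V) :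
    (G.interedges A B).card = ∑ u ∈ A, (B.filter fun v => G.Adj u v).card := by
  simp only [SimpleGraph.interedges, Rel.interedges, Finset.card_filter, Finset.sum_product]

theorem exists_regular_restriction {V : Type*} [Fintype V] [DecidableEq V]
    (G : SimpleGraph V) [DecidableRel G.Adj] {U : Finset V} (hcard : 5184 ≤ U.card)
    (hmax : ∀ W : Finset V, (G.interedges W W).card ^ 3 * U.card ^ 4 ≤
      (G.interedges U U).card ^ 3 * W.card ^ 4) :
    ∃ (H : SimpleGraph U) (_ : DecidableRel H.Adj), (∀ u v, H.Adj u v → G.Adj u v) ∧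
      (∀ v, (H.neighborFinset v).card ≤ 5184 * (G.interedges U U).card / U.card) ∧
      (G.interedges U U).card ≤ 2 * ∑ v, (H.neighborFinset v).card := by
  set E := (G.interedges U U).card with hE
  let d : V → ℕ := fun u => (U.filter fun v => G.Adj u v).card
  let A := U.filter fun u => 5184 * E < U.card * d u
  have hsumd : ∑ u ∈ U, d u = E := (card_interedges_eq_sum G U U).symm
  have hA : A.card * 5184 ≤ U.card := by
    by_contra! hlt
    have h1 : A.card * (5184 * E + 1) ≤ ∑ u ∈ A, U.card * d u :=
      Finset.card_nsmul_le_sum A (fun u => U.card * d u) _ fun u hu => (Finset.mem_filter.1 hu).2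
    have h2 : ∑ u ∈ A, U.card * d u ≤ U.card * E := by
      rw [← Finset.mul_sum, ← hsumd]
      exact Nat.mul_le_mul_left _ (Finset.sum_le_sum_of_subset (Finset.filter_subset _ _))
    have h3 : 0 < A.card := by omega
    nlinarith
  have h4 := four_mul_card_interedges_le G hcard hA hmax
  let H : SimpleGraph U :=
    { Adj := fun u v => G.Adj u v ∧ (u : V) ∉ A ∧ (v : V) ∉ A
      symm := ⟨fun u v h => ⟨h.1.symm, h.2.2, h.2.1⟩⟩
      loopless := ⟨fun u h => G.loopless.irrefl _ h.1⟩ }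
  let _ : DecidableRel H.Adj := fun _ _ => inferInstanceAs (Decidable (_ ∧ _))
  have hdeg : ∀ v : U, (H.neighborFinset v).card =
      (U.filter fun w => G.Adj v w ∧ (v : V) ∉ A ∧ w ∉ A).card := by
    intro v
    rw [← Finset.card_map ⟨Subtype.val, Subtype.val_injective⟩]
    congr 1
    ext w
    simp only [Finset.mem_map, SimpleGraph.mem_neighborFinset, Function.Embedding.coeFn_mk,
      Finset.mem_filter, H]
    constructor
    · rintro ⟨w, h, rfl⟩
      exact ⟨w.2, h⟩
    · rintro ⟨hw, h⟩
      exact ⟨⟨w, hw⟩, h, rfl⟩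
  refine ⟨H, inferInstance, fun u v h => h.1, fun v => ?_, ?_⟩
  · rw [hdeg, Nat.le_div_iff_mul_le (by omega), mul_comm]
    by_cases hv : (v : V) ∈ A
    · simp [hv]
    · have h5 : U.card * d v ≤ 5184 * E := by
        by_contra! h
        exact hv (Finset.mem_filter.2 ⟨v.2, h⟩)
      refine le_trans (Nat.mul_le_mul_left _ (Finset.card_le_card ?_)) h5
      intro w hw
      simp only [Finset.mem_filter] at hw ⊢
      exact ⟨hw.1, hw.2.1⟩
  · have h5 : ∑ v, (H.neighborFinset v).card =
        (((U ×ˢ U).filter fun p => G.Adj p.1 p.2 ∧ p.1 ∉ A ∧ p.2 ∉ A)).card := by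
      simp only [hdeg, Finset.card_filter, Finset.sum_product]
      exact Finset.sum_coe_sort U fun v =>
        ∑ w ∈ U, if G.Adj v w ∧ v ∉ A ∧ w ∉ A then 1 else 0
    have := G.symm
    have h6 : (G.interedges U A).card = (G.interedges A U).card :=
      Rel.card_interedges_comm _ _
    have h7 : G.interedges U U ⊆
        ((U ×ˢ U).filter fun p => G.Adj p.1 p.2 ∧ p.1 ∉ A ∧ p.2 ∉ A) ∪
          (G.interedges A U ∪ G.interedges U A) := by
      rintro ⟨u, v⟩ h
      simp only [Finset.mem_union, Finset.mem_filter, Finset.mem_product,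
        SimpleGraph.mem_interedges_iff] at h ⊢
      tauto
    have h8 := (Finset.card_le_card h7).trans (Finset.card_union_le _ _)
    have h9 := Finset.card_union_le (G.interedges A U) (G.interedges U A)
    rw [h5]
    omega

theorem ContainsCopy.of_hom {V W : Type*} {G : SimpleGraph V} {H : SimpleGraph W} {β : Type*}
    {F : SimpleGraph β} (h : ContainsCopy H F) {f : W → V} (hf : Function.Injective f)
    (hadj : ∀ u v, H.Adj u v → G.Adj (f u) (f v)) : ContainsCopy G F := by
  obtain ⟨g, hg, hgadj⟩ := h
  exact ⟨f ∘ g, hf.comp hg, fun u v huv => hadj _ _ (hgadj u v huv)⟩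

theorem exists_card_interedges_cube_le_of_triangleFree : ∃ C : ℝ, 0 < C ∧
    ∀ (V : Type) [Fintype V] [DecidableEq V] [Nonempty V] (G : SimpleGraph V)
      [DecidableRel G.Adj], (∀ u v w, G.Adj u v → G.Adj v w → ¬ G.Adj u w) →
      ¬ ContainsCopy G KsubThreeTwentyFive →
      ((G.interedges Finset.univ Finset.univ).card : ℝ) ^ 3 ≤ C * (Fintype.card V : ℝ) ^ 4 := by
  obtain ⟨C, hC, hcore⟩ := exists_maxDegree_pow_six_le 10368 (by norm_num)
  refine ⟨5184 ^ 2 + C + 1, by positivity, ?_⟩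
  intro V _ _ _ G _ htf hG
  obtain ⟨U, hU, hmax⟩ := exists_max_ratio_interedges G
  have hU0 : (0 : ℝ) < U.card := by exact_mod_cast hU.card_pos
  suffices hR : ((G.interedges U U).card : ℝ) ^ 3 ≤ (5184 ^ 2 + C + 1) * (U.card : ℝ) ^ 4 by
    have h1 : ((G.interedges Finset.univ Finset.univ).card : ℝ) ^ 3 * (U.card : ℝ) ^ 4 ≤
        ((G.interedges U U).card : ℝ) ^ 3 * (Fintype.card V : ℝ) ^ 4 := by
      exact_mod_cast hmax Finset.univ
    have h2 : ((G.interedges Finset.univ Finset.univ).card : ℝ) ^ 3 * (U.card : ℝ) ^ 4 ≤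
        ((5184 ^ 2 + C + 1) * (Fintype.card V : ℝ) ^ 4) * (U.card : ℝ) ^ 4 := by
      calc _ ≤ _ := h1
        _ ≤ ((5184 ^ 2 + C + 1) * (U.card : ℝ) ^ 4) * (Fintype.card V : ℝ) ^ 4 := by gcongr
        _ = _ := by ring
    exact le_of_mul_le_mul_right h2 (by positivity)
  set E := (G.interedges U U).card with hE
  set m := U.card with hm
  have hEm : E ≤ m ^ 2 := by
    rw [sq]
    exact Rel.card_interedges_le_mul _ _ _
  have hm1 : (1 : ℝ) ≤ m := by exact_mod_cast hU.card_pos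
  by_cases hsmall : m < 5184
  · have h1 : (E : ℝ) ≤ (m : ℝ) ^ 2 := by exact_mod_cast hEm
    have h2 : (m : ℝ) ≤ 5184 := by exact_mod_cast hsmall.le
    calc (E : ℝ) ^ 3 ≤ ((m : ℝ) ^ 2) ^ 3 := by gcongr
      _ = (m : ℝ) ^ 2 * (m : ℝ) ^ 4 := by ring
      _ ≤ 5184 ^ 2 * (m : ℝ) ^ 4 := by gcongr
      _ ≤ _ := by gcongr; linarith
  by_cases hfew : E < m
  · have h1 : (E : ℝ) ≤ m := by exact_mod_cast hfew.le
    calc (E : ℝ) ^ 3 ≤ (m : ℝ) ^ 3 := by gcongr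
      _ ≤ (m : ℝ) ^ 4 := pow_le_pow_right₀ hm1 (by norm_num)
      _ = 1 * (m : ℝ) ^ 4 := by ring
      _ ≤ _ := by gcongr; linarith [show (0 : ℝ) ≤ 5184 ^ 2 by positivity]
  push Not at hsmall hfew
  obtain ⟨H, _, hHG, hdeg, hsum⟩ := exists_regular_restriction G hsmall hmax
  have : Nonempty U := hU.to_subtype
  have hD := hcore U H (5184 * E / m) (fun u v w h1 h2 h3 => htf u v w (hHG _ _ h1) (hHG _ _ h2)
    (hHG _ _ h3)) (fun h => hG (h.of_hom Subtype.val_injective hHG)) hdeg (by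
      have h1 : m * (5184 * E / m) ≤ 10368 * ∑ v, (H.neighborFinset v).card := by
        have := Nat.mul_div_le (5184 * E) m
        omega
      rw [Fintype.card_coe]
      exact_mod_cast h1)
  rw [Fintype.card_coe] at hD
  have hlow : E ≤ m * (5184 * E / m) := by
    have := Nat.lt_mul_div_succ (5184 * E) (show 0 < m by omega)
    rw [Nat.mul_add] at this
    omega
  have hlow' : (E : ℝ) ≤ m * ((5184 * E / m : ℕ) : ℝ) := by exact_mod_cast hlow
  set D := ((5184 * E / m : ℕ) : ℝ)
  have h6 : ((E : ℝ) ^ 3) ^ 2 ≤ ((C + 1) * (m : ℝ) ^ 4) ^ 2 := by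
    calc ((E : ℝ) ^ 3) ^ 2 = (E : ℝ) ^ 6 := by ring
      _ ≤ (m * D) ^ 6 := by gcongr
      _ = (m : ℝ) ^ 6 * D ^ 6 := by ring
      _ ≤ (m : ℝ) ^ 6 * (C * (m : ℝ) ^ 2) := by gcongr
      _ = C * (m : ℝ) ^ 8 := by ring
      _ ≤ (C + 1) ^ 2 * (m : ℝ) ^ 8 := by gcongr; nlinarith
      _ = _ := by ring
  have h7 := le_of_sq_le_sq h6 (by positivity)
  refine h7.trans ?_
  gcongr
  linarith [show (0 : ℝ) ≤ 5184 ^ 2 by positivity]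

end Regularization

section UpperBound

theorem exists_large_cut {V : Type*} [Fintype V] [DecidableEq V] (G : SimpleGraph V)
    [DecidableRel G.Adj] : ∃ σ : V → Bool, (G.interedges Finset.univ Finset.univ).card ≤
      2 * ((G.interedges Finset.univ Finset.univ).filter fun p => σ p.1 ≠ σ p.2).card := by
  set F := G.interedges Finset.univ Finset.univ
  have hhalf : ∀ p ∈ F, 2 * (Finset.univ.filter fun σ : V → Bool => σ p.1 ≠ σ p.2).card =
      Fintype.card (V → Bool) := by
    rintro ⟨u, v⟩ hp
    have huv : u ≠ v := ((SimpleGraph.mem_interedges_iff G).1 hp).2.2.ne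
    have h1 := Finset.card_filter_add_card_filter_not (s := (Finset.univ : Finset (V → Bool)))
      (fun σ => σ u ≠ σ v)
    have h2 : (Finset.univ.filter fun σ : V → Bool => σ u ≠ σ v).card =
        (Finset.univ.filter fun σ : V → Bool => ¬ σ u ≠ σ v).card := by
      refine Finset.card_nbij' (fun σ => Function.update σ u (!σ u))
        (fun σ => Function.update σ u (!σ u)) ?_ ?_ ?_ ?_
      · intro σ hσ
        simp only [Finset.coe_filter, Finset.mem_univ, true_and, Set.mem_ofPred_eq,
          Function.update_self, Function.update_of_ne huv.symm] at hσ ⊢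
        revert hσ
        cases σ u <;> cases σ v <;> simp
      · intro σ hσ
        simp only [Finset.coe_filter, Finset.mem_univ, true_and, Set.mem_ofPred_eq,
          Function.update_self, Function.update_of_ne huv.symm] at hσ ⊢
        revert hσ
        cases σ u <;> cases σ v <;> simp
      · intro σ _
        simp
      · intro σ _
        simp
    rw [Finset.card_univ] at h1
    simp only at h1 h2 ⊢
    omega
  by_contra! hlt
  have h1 : ∑ σ : V → Bool, 2 * (F.filter fun p => σ p.1 ≠ σ p.2).card <
      ∑ _σ : V → Bool, F.card :=
    Finset.sum_lt_sum_of_nonempty Finset.univ_nonempty fun σ _ => hlt σ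
  have h2 : ∑ σ : V → Bool, 2 * (F.filter fun p => σ p.1 ≠ σ p.2).card =
      ∑ p ∈ F, 2 * (Finset.univ.filter fun σ : V → Bool => σ p.1 ≠ σ p.2).card := by
    simp only [← Finset.mul_sum, Finset.card_eq_sum_ones]
    congr 1
    refine Finset.sum_comm' fun σ p => ?_
    simp
    tauto
  rw [h2, Finset.sum_congr rfl hhalf] at h1
  simp [mul_comm] at h1

theorem exists_card_interedges_cube_le : ∃ C : ℝ, 0 < C ∧
    ∀ (V : Type) [Fintype V] [DecidableEq V] [Nonempty V] (G : SimpleGraph V)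
      [DecidableRel G.Adj], ¬ ContainsCopy G KsubThreeTwentyFive →
      ((G.interedges Finset.univ Finset.univ).card : ℝ) ^ 3 ≤ C * (Fintype.card V : ℝ) ^ 4 := by
  obtain ⟨C, hC, h⟩ := exists_card_interedges_cube_le_of_triangleFree
  refine ⟨8 * C, by positivity, ?_⟩
  intro V _ _ _ G _ hG
  obtain ⟨σ, hσ⟩ := exists_large_cut G
  let H : SimpleGraph V :=
    { Adj := fun u v => G.Adj u v ∧ σ u ≠ σ v
      symm := ⟨fun u v h => ⟨h.1.symm, h.2.symm⟩⟩
      loopless := ⟨fun u h => h.2 rfl⟩ }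
  let _ : DecidableRel H.Adj := fun _ _ => inferInstanceAs (Decidable (_ ∧ _))
  have hHtf : ∀ u v w, H.Adj u v → H.Adj v w → ¬ H.Adj u w := by
    rintro u v w ⟨-, h1⟩ ⟨-, h2⟩ ⟨-, h3⟩
    revert h1 h2 h3
    cases σ u <;> cases σ v <;> cases σ w <;> simp
  have hcard : (G.interedges Finset.univ Finset.univ).filter (fun p => σ p.1 ≠ σ p.2) =
      H.interedges Finset.univ Finset.univ := by
    ext p
    simp [SimpleGraph.mem_interedges_iff, H]
  rw [hcard] at hσ
  have h1 := h V H hHtf fun hc => hG (hc.of_hom Function.injective_id fun u v huv => huv.1)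
  have h2 : ((G.interedges Finset.univ Finset.univ).card : ℝ) ≤
      2 * (H.interedges Finset.univ Finset.univ).card := by exact_mod_cast hσ
  calc _ ≤ (2 * ((H.interedges Finset.univ Finset.univ).card : ℝ)) ^ 3 := by gcongr
    _ = 8 * ((H.interedges Finset.univ Finset.univ).card : ℝ) ^ 3 := by ring
    _ ≤ 8 * (C * (Fintype.card V : ℝ) ^ 4) := by gcongr
    _ = _ := by ring

theorem card_interedges_univ {V : Type*} [Fintype V] [DecidableEq V] (G : SimpleGraph V)
    [DecidableRel G.Adj] :
    (G.interedges Finset.univ Finset.univ).card = 2 * G.edgeSet.ncard := by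
  rw [← SimpleGraph.coe_edgeFinset, Set.ncard_coe_finset, ← G.sum_degrees_eq_twice_card_edges,
    card_interedges_eq_sum]
  refine Finset.sum_congr rfl fun v _ => ?_
  rw [← SimpleGraph.card_neighborFinset_eq_degree, SimpleGraph.neighborFinset_eq_filter]

theorem exists_edge_upper_bound : ∃ c : ℝ, 0 < c ∧ ∀ n : ℕ, 1 ≤ n → ∀ G : SimpleGraph (Fin n),
    ¬ ContainsCopy G KsubThreeTwentyFive →
      (G.edgeSet.ncard : ℝ) ≤ c * (n : ℝ) ^ ((4 : ℝ) / 3) := by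
  classical
  obtain ⟨C, hC, h⟩ := exists_card_interedges_cube_le
  refine ⟨C + 1, by positivity, ?_⟩
  intro n hn G hG
  have : Nonempty (Fin n) := ⟨⟨0, hn⟩⟩
  have h1 := h (Fin n) G hG
  rw [card_interedges_univ, Fintype.card_fin] at h1
  push_cast at h1
  have h2 : ((n : ℝ) ^ ((4 : ℝ) / 3)) ^ 3 = (n : ℝ) ^ 4 := by
    rw [← Real.rpow_natCast, ← Real.rpow_mul (Nat.cast_nonneg n)]
    norm_num
  refine le_of_pow_le_pow_left₀ three_ne_zero (by positivity) ?_
  rw [mul_pow, h2]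
  have h3 : C ≤ (C + 1) ^ 3 := by nlinarith [sq_nonneg C, pow_pos hC 3]
  calc (G.edgeSet.ncard : ℝ) ^ 3 ≤ (2 * (G.edgeSet.ncard : ℝ)) ^ 3 := by
        gcongr
        linarith [show (0 : ℝ) ≤ G.edgeSet.ncard from Nat.cast_nonneg _]
    _ ≤ C * (n : ℝ) ^ 4 := h1
    _ ≤ _ := by gcongr

end UpperBound

section Algebra

open Polynomial in
theorem resultant_vanishes {F : Type*} [Field F] {R : Finset F} (hR : 13 ≤ R.card)
    {a₁ a₂ b c₁ c₂ n₀ n₁ n₂ n₃ n₄ n₅ d₀ d₁ d₂ : F} {N D : F → F}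
    (hN : ∀ x, N x = n₀ + n₁ * x + n₂ * x ^ 2 + n₃ * x ^ 3 + n₄ * x ^ 4 + n₅ * x ^ 5)
    (hD : ∀ x, D x = d₀ + d₁ * x + d₂ * x ^ 2)
    (h : ∀ x ∈ R, (x - a₂) * (x + a₂) ^ 2 * (N x - c₁ * D x) ^ 2 -
      (x - a₁) * (x + a₁) ^ 2 * (N x - c₂ * D x) ^ 2 =
        D x ^ 2 * ((x - a₁) * (x + a₁) ^ 2) * ((x - a₂) * (x + a₂) ^ 2) * b) :
    (∀ x, (x - a₂) * (x + a₂) ^ 2 * (N x - c₁ * D x) ^ 2 -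
      (x - a₁) * (x + a₁) ^ 2 * (N x - c₂ * D x) ^ 2 =
        D x ^ 2 * ((x - a₁) * (x + a₁) ^ 2) * ((x - a₂) * (x + a₂) ^ 2) * b) ∧
      (a₂ - a₁) * n₅ ^ 2 = 0 := by
  let PN : F[X] := C n₀ + C n₁ * X + C n₂ * X ^ 2 + C n₃ * X ^ 3 + C n₄ * X ^ 4 + C n₅ * X ^ 5
  let PD : F[X] := C d₀ + C d₁ * X + C d₂ * X ^ 2
  let P₁ : F[X] := X ^ 3 + C a₁ * X ^ 2 - C (a₁ ^ 2) * X - C (a₁ ^ 3)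
  let P₂ : F[X] := X ^ 3 + C a₂ * X ^ 2 - C (a₂ ^ 2) * X - C (a₂ ^ 3)
  let W : F[X] := C (a₂ - a₁) * X ^ 2 - C (a₂ ^ 2 - a₁ ^ 2) * X - C (a₂ ^ 3 - a₁ ^ 3)
  let Q : F[X] := P₁ * (C (2 * c₂) * PN * PD - C (c₂ ^ 2) * PD ^ 2)
    - P₂ * (C (2 * c₁) * PN * PD - C (c₁ ^ 2) * PD ^ 2) - C b * PD ^ 2 * P₁ * P₂
  let P : F[X] := W * PN ^ 2 + Q
  have hPN : PN.natDegree ≤ 5 := by simp only [PN]; compute_degree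
  have hPD : PD.natDegree ≤ 2 := by simp only [PD]; compute_degree
  have hP₁ : P₁.natDegree ≤ 3 := by simp only [P₁]; compute_degree
  have hP₂ : P₂.natDegree ≤ 3 := by simp only [P₂]; compute_degree
  have hW : W.natDegree ≤ 2 := by simp only [W]; compute_degree
  have hQ : Q.natDegree ≤ 10 := by
    have h1 : ∀ c : F, (C (2 * c) * PN * PD - C (c ^ 2) * PD ^ 2).natDegree ≤ 7 := by
      intro c
      refine (natDegree_sub_le _ _).trans (max_le ?_ ?_)
      · exact natDegree_mul_le_of_le (m := 5) (n := 2)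
          ((natDegree_C_mul_le _ _).trans hPN) hPD
      · exact (natDegree_C_mul_le _ _).trans
          ((natDegree_pow_le_of_le 2 hPD).trans (by norm_num))
    refine (natDegree_sub_le _ _).trans (max_le ((natDegree_sub_le _ _).trans (max_le ?_ ?_)) ?_)
    · exact natDegree_mul_le_of_le (m := 3) (n := 7) hP₁ (h1 _)
    · exact natDegree_mul_le_of_le (m := 3) (n := 7) hP₂ (h1 _)
    · exact natDegree_mul_le_of_le (m := 7) (n := 3) (natDegree_mul_le_of_le (m := 4) (n := 3)
        ((natDegree_C_mul_le _ _).trans (natDegree_pow_le_of_le 2 hPD)) hP₁) hP₂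
  have hPN2 : (PN ^ 2).natDegree ≤ 10 := natDegree_pow_le_of_le 2 hPN
  have hP : P.natDegree ≤ 12 := by
    exact (natDegree_add_le _ _).trans (max_le
      (natDegree_mul_le_of_le (m := 2) (n := 10) hW hPN2) (hQ.trans (by norm_num)))
  have heval : ∀ x, P.eval x = (x - a₂) * (x + a₂) ^ 2 * (N x - c₁ * D x) ^ 2 -
      (x - a₁) * (x + a₁) ^ 2 * (N x - c₂ * D x) ^ 2 -
        D x ^ 2 * ((x - a₁) * (x + a₁) ^ 2) * ((x - a₂) * (x + a₂) ^ 2) * b := by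
    intro x
    have e1 : PN.eval x = N x := by simp [PN, hN]
    have e2 : PD.eval x = D x := by simp [PD, hD]
    simp only [P, Q, P₁, P₂, W, eval_add, eval_sub, eval_mul, eval_pow, e1, e2, eval_C, eval_X]
    ring
  have hP0 : P = 0 := by
    refine eq_zero_of_natDegree_lt_card_of_eval_eq_zero' P R (fun x hx => ?_) (by omega)
    rw [heval, h x hx, sub_self]
  refine ⟨fun x => ?_, ?_⟩
  · have := heval x
    rw [hP0, eval_zero] at this
    exact (sub_eq_zero.1 this.symm)
  · have h12 : P.coeff 12 = (a₂ - a₁) * n₅ ^ 2 := by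
      have h1 : Q.coeff 12 = 0 := coeff_eq_zero_of_natDegree_lt (by omega)
      have h2 : W.coeff 2 = a₂ - a₁ := by simp only [W]; compute_degree!
      have h3 : PN.coeff 5 = n₅ := by simp only [PN]; compute_degree!
      have h4 : (PN ^ 2).coeff 10 = n₅ ^ 2 := by
        rw [← h3]; exact coeff_pow_of_natDegree_le hPN
      simp only [P, coeff_add, h1, add_zero]
      rw [show 12 = 2 + 10 from rfl, coeff_mul_add_eq_of_natDegree_le hW hPN2, h2, h4]
    rw [← h12, hP0, coeff_zero]

/-- The cubic `(x - a) (x + a) ^ 2` attached to the parameter `a`. -/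
def cubicForm {F : Type*} [Field F] (a x : F) : F := (x - a) * (x + a) ^ 2

theorem add_add_add_eq_zero_of_cubicForm_eq {F : Type*} [Field F] {a₁ a₂ a₃ x : F}
    (h12 : a₁ ≠ a₂) (h13 : a₁ ≠ a₃) (h23 : a₂ ≠ a₃) (e12 : cubicForm a₁ x = cubicForm a₂ x)
    (e13 : cubicForm a₁ x = cubicForm a₃ x) : x + a₁ + a₂ + a₃ = 0 := by
  simp only [cubicForm] at e12 e13
  have h1 : x ^ 2 - x * (a₁ + a₂) - (a₁ ^ 2 + a₁ * a₂ + a₂ ^ 2) = 0 := by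
    refine (mul_eq_zero.1 ?_).resolve_left (sub_ne_zero.2 h12)
    linear_combination e12
  have h2 : x ^ 2 - x * (a₁ + a₃) - (a₁ ^ 2 + a₁ * a₃ + a₃ ^ 2) = 0 := by
    refine (mul_eq_zero.1 ?_).resolve_left (sub_ne_zero.2 h13)
    linear_combination e13
  refine (mul_eq_zero.1 (?_ : (a₂ - a₃) * (x + a₁ + a₂ + a₃) = 0)).resolve_left
    (sub_ne_zero.2 h23)
  linear_combination h2 - h1

theorem false_of_distinct_parameters {F : Type*} [Field F] {R : Finset F} (hR : 13 ≤ R.card)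
    {a₁ a₂ a₃ b₁ b₂ b₃ c₁ c₂ c₃ : F} (h12 : a₁ ≠ a₂) (h13 : a₁ ≠ a₃) (h23 : a₂ ≠ a₃)
    (h2 : (2 : F) ≠ 0) (ha₁ : a₁ ≠ 0) (ha₂ : a₂ ≠ 0) (ha₃ : a₃ ≠ 0)
    (s12 : a₁ + a₂ ≠ 0) (s13 : a₁ + a₃ ≠ 0) (s23 : a₂ + a₃ ≠ 0)
    (hRadd : ∀ x ∈ R, ∀ x' ∈ R, x + x' ≠ 0) (h4 : ∀ x ∈ R, x + a₁ + a₂ + a₃ ≠ 0)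
    (hpt : ∀ x ∈ R, ∃ y z, cubicForm a₁ x * (y - b₁) = (z - c₁) ^ 2 ∧
      cubicForm a₂ x * (y - b₂) = (z - c₂) ^ 2 ∧ cubicForm a₃ x * (y - b₃) = (z - c₃) ^ 2 ∧
      (z - c₁) * (x ^ 2 - a₂ ^ 2) ≠ (z - c₂) * (x ^ 2 - a₁ ^ 2)) : False := by
  simp only [cubicForm] at hpt
  obtain ⟨n₀, hn₀⟩ : ∃ n, n = (a₂ ^ 3 - a₃ ^ 3) * (a₁ ^ 3 * b₁ - c₁ ^ 2) +
    (a₃ ^ 3 - a₁ ^ 3) * (a₂ ^ 3 * b₂ - c₂ ^ 2) + (a₁ ^ 3 - a₂ ^ 3) * (a₃ ^ 3 * b₃ - c₃ ^ 2) :=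
    ⟨_, rfl⟩
  obtain ⟨n₁, hn₁⟩ : ∃ n, n =
    ((a₂ ^ 2 - a₃ ^ 2) * a₁ ^ 3 + (a₂ ^ 3 - a₃ ^ 3) * a₁ ^ 2) * b₁ - (a₂ ^ 2 - a₃ ^ 2) * c₁ ^ 2 +
    (((a₃ ^ 2 - a₁ ^ 2) * a₂ ^ 3 + (a₃ ^ 3 - a₁ ^ 3) * a₂ ^ 2) * b₂ -
      (a₃ ^ 2 - a₁ ^ 2) * c₂ ^ 2) +
    (((a₁ ^ 2 - a₂ ^ 2) * a₃ ^ 3 + (a₁ ^ 3 - a₂ ^ 3) * a₃ ^ 2) * b₃ -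
      (a₁ ^ 2 - a₂ ^ 2) * c₃ ^ 2) := ⟨_, rfl⟩
  obtain ⟨n₂, hn₂⟩ : ∃ n, n =
    (-(a₂ - a₃) * a₁ ^ 3 + (a₂ ^ 2 - a₃ ^ 2) * a₁ ^ 2 - (a₂ ^ 3 - a₃ ^ 3) * a₁) * b₁ +
      (a₂ - a₃) * c₁ ^ 2 +
    ((-(a₃ - a₁) * a₂ ^ 3 + (a₃ ^ 2 - a₁ ^ 2) * a₂ ^ 2 - (a₃ ^ 3 - a₁ ^ 3) * a₂) * b₂ +
      (a₃ - a₁) * c₂ ^ 2) +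
    ((-(a₁ - a₂) * a₃ ^ 3 + (a₁ ^ 2 - a₂ ^ 2) * a₃ ^ 2 - (a₁ ^ 3 - a₂ ^ 3) * a₃) * b₃ +
      (a₁ - a₂) * c₃ ^ 2) := ⟨_, rfl⟩
  obtain ⟨n₃, hn₃⟩ : ∃ n, n =
    -((a₂ - a₃) * a₁ ^ 2 + (a₂ ^ 2 - a₃ ^ 2) * a₁ + (a₂ ^ 3 - a₃ ^ 3)) * b₁ -
    ((a₃ - a₁) * a₂ ^ 2 + (a₃ ^ 2 - a₁ ^ 2) * a₂ + (a₃ ^ 3 - a₁ ^ 3)) * b₂ -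
    ((a₁ - a₂) * a₃ ^ 2 + (a₁ ^ 2 - a₂ ^ 2) * a₃ + (a₁ ^ 3 - a₂ ^ 3)) * b₃ := ⟨_, rfl⟩
  obtain ⟨n₄, hn₄⟩ : ∃ n, n = ((a₂ - a₃) * a₁ - (a₂ ^ 2 - a₃ ^ 2)) * b₁ +
    ((a₃ - a₁) * a₂ - (a₃ ^ 2 - a₁ ^ 2)) * b₂ + ((a₁ - a₂) * a₃ - (a₁ ^ 2 - a₂ ^ 2)) * b₃ :=
    ⟨_, rfl⟩
  obtain ⟨n₅, hn₅⟩ : ∃ n, n = (a₂ - a₃) * b₁ + (a₃ - a₁) * b₂ + (a₁ - a₂) * b₃ := ⟨_, rfl⟩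
  obtain ⟨d₀, hd₀⟩ : ∃ d, d = -2 * ((a₂ ^ 3 - a₃ ^ 3) * c₁ + (a₃ ^ 3 - a₁ ^ 3) * c₂ +
    (a₁ ^ 3 - a₂ ^ 3) * c₃) := ⟨_, rfl⟩
  obtain ⟨d₁, hd₁⟩ : ∃ d, d = -2 * ((a₂ ^ 2 - a₃ ^ 2) * c₁ + (a₃ ^ 2 - a₁ ^ 2) * c₂ +
    (a₁ ^ 2 - a₂ ^ 2) * c₃) := ⟨_, rfl⟩
  obtain ⟨d₂, hd₂⟩ : ∃ d, d = 2 * ((a₂ - a₃) * c₁ + (a₃ - a₁) * c₂ + (a₁ - a₂) * c₃) :=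
    ⟨_, rfl⟩
  obtain ⟨N, hN⟩ : ∃ N : F → F, ∀ x, N x =
    n₀ + n₁ * x + n₂ * x ^ 2 + n₃ * x ^ 3 + n₄ * x ^ 4 + n₅ * x ^ 5 := ⟨_, fun _ => rfl⟩
  obtain ⟨D, hD⟩ : ∃ D : F → F, ∀ x, D x = d₀ + d₁ * x + d₂ * x ^ 2 := ⟨_, fun _ => rfl⟩
  have hz : ∀ x y z, (x - a₁) * (x + a₁) ^ 2 * (y - b₁) = (z - c₁) ^ 2 →
      (x - a₂) * (x + a₂) ^ 2 * (y - b₂) = (z - c₂) ^ 2 →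
      (x - a₃) * (x + a₃) ^ 2 * (y - b₃) = (z - c₃) ^ 2 → z * D x = N x := by
    intro x y z e1 e2 e3
    rw [hN, hD, hn₀, hn₁, hn₂, hn₃, hn₄, hn₅, hd₀, hd₁, hd₂]
    linear_combination
      ((a₂ - a₃) * x ^ 2 - (a₂ ^ 2 - a₃ ^ 2) * x - (a₂ ^ 3 - a₃ ^ 3)) * e1 +
      ((a₃ - a₁) * x ^ 2 - (a₃ ^ 2 - a₁ ^ 2) * x - (a₃ ^ 3 - a₁ ^ 3)) * e2 +
      ((a₁ - a₂) * x ^ 2 - (a₁ ^ 2 - a₂ ^ 2) * x - (a₁ ^ 3 - a₂ ^ 3)) * e3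
  obtain ⟨r12, hlead⟩ := resultant_vanishes hR (a₁ := a₁) (a₂ := a₂) (b := b₂ - b₁) (c₁ := c₁)
    (c₂ := c₂) hN hD (by
      intro x hx
      obtain ⟨y, z, e1, e2, e3, -⟩ := hpt x hx
      rw [← hz x y z e1 e2 e3]
      linear_combination D x ^ 2 * ((x - a₁) * (x + a₁) ^ 2 * e2 - (x - a₂) * (x + a₂) ^ 2 * e1))
  obtain ⟨r13, -⟩ := resultant_vanishes hR (a₁ := a₁) (a₂ := a₃) (b := b₃ - b₁) (c₁ := c₁)
    (c₂ := c₃) hN hD (by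
      intro x hx
      obtain ⟨y, z, e1, e2, e3, -⟩ := hpt x hx
      rw [← hz x y z e1 e2 e3]
      linear_combination D x ^ 2 * ((x - a₁) * (x + a₁) ^ 2 * e3 - (x - a₃) * (x + a₃) ^ 2 * e1))
  have hn5 : n₅ = 0 := by
    simpa [sub_ne_zero.2 h12.symm] using hlead
  have key : ∀ {k u v : F}, u ≠ 0 → u * (v - k) ^ 2 = 0 → v = k := by
    intro k u v hu h
    exact sub_eq_zero.1 (pow_eq_zero_iff two_ne_zero |>.1 ((mul_eq_zero.1 h).resolve_left hu))
  have d12 := sub_ne_zero.2 h12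
  have d13 := sub_ne_zero.2 h13
  have d23 := sub_ne_zero.2 h23
  have p1 : N a₁ = c₁ * D a₁ := key (u := (a₁ - a₂) * (a₁ + a₂) ^ 2)
    (mul_ne_zero d12 (pow_ne_zero _ s12)) (by linear_combination r12 a₁)
  have m1 : N (-a₁) = c₁ * D (-a₁) := key (u := -(a₁ + a₂) * (a₁ - a₂) ^ 2)
    (mul_ne_zero (neg_ne_zero.2 s12) (pow_ne_zero _ d12)) (by linear_combination r12 (-a₁))
  have p2 : N a₂ = c₂ * D a₂ := key (u := (a₁ - a₂) * (a₁ + a₂) ^ 2)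
    (mul_ne_zero d12 (pow_ne_zero _ s12)) (by linear_combination r12 a₂)
  have m2 : N (-a₂) = c₂ * D (-a₂) := key (u := (a₁ + a₂) * (a₁ - a₂) ^ 2)
    (mul_ne_zero s12 (pow_ne_zero _ d12)) (by linear_combination r12 (-a₂))
  have p3 : N a₃ = c₃ * D a₃ := key (u := (a₁ - a₃) * (a₁ + a₃) ^ 2)
    (mul_ne_zero d13 (pow_ne_zero _ s13)) (by linear_combination r13 a₃)
  have m3 : N (-a₃) = c₃ * D (-a₃) := key (u := (a₁ + a₃) * (a₁ - a₃) ^ 2)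
    (mul_ne_zero s13 (pow_ne_zero _ d13)) (by linear_combination r13 (-a₃))
  have odd : ∀ {a c : F}, a ≠ 0 → N a = c * D a → N (-a) = c * D (-a) →
      n₁ + n₃ * a ^ 2 = c * d₁ := by
    intro a c ha e e'
    rw [hN, hD] at e e'
    refine mul_left_cancel₀ (mul_ne_zero h2 ha) ?_
    linear_combination e - e' - 2 * a ^ 5 * hn5
  have even : ∀ {a c : F}, N a = c * D a → N (-a) = c * D (-a) →
      n₀ + n₂ * a ^ 2 + n₄ * a ^ 4 = c * (d₀ + d₂ * a ^ 2) := by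
    intro a c e e'
    rw [hN, hD] at e e'
    refine mul_left_cancel₀ h2 ?_
    linear_combination e + e'
  have o1 := odd ha₁ p1 m1
  have o2 := odd ha₂ p2 m2
  have o3 := odd ha₃ p3 m3
  have q1 := even p1 m1
  have q2 := even p2 m2
  have q3 := even p3 m3
  have D1 : d₁ = 0 := by
    refine pow_eq_zero_iff two_ne_zero |>.1 ?_
    linear_combination d₁ * hd₁ + 2 * ((a₂ ^ 2 - a₃ ^ 2) * o1 + (a₃ ^ 2 - a₁ ^ 2) * o2 +
      (a₁ ^ 2 - a₂ ^ 2) * o3)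
  have t12 : a₁ ^ 2 - a₂ ^ 2 ≠ 0 := by
    rw [sq_sub_sq]; exact mul_ne_zero s12 d12
  have t13 : a₁ ^ 2 - a₃ ^ 2 ≠ 0 := by
    rw [sq_sub_sq]; exact mul_ne_zero s13 d13
  have t23 : a₂ ^ 2 - a₃ ^ 2 ≠ 0 := by
    rw [sq_sub_sq]; exact mul_ne_zero s23 d23
  obtain ⟨k₁, hk₁⟩ : ∃ k, c₁ - c₂ = k * (a₁ ^ 2 - a₂ ^ 2) :=
    ⟨(c₁ - c₂) / (a₁ ^ 2 - a₂ ^ 2), (div_mul_cancel₀ _ t12).symm⟩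
  obtain ⟨k₀, hc₁⟩ : ∃ k, c₁ = k + k₁ * a₁ ^ 2 := ⟨c₁ - k₁ * a₁ ^ 2, by ring⟩
  have hc₂ : c₂ = k₀ + k₁ * a₂ ^ 2 := by linear_combination hc₁ - hk₁
  have hc₃ : c₃ = k₀ + k₁ * a₃ ^ 2 := by
    refine mul_left_cancel₀ (mul_ne_zero h2 t12) ?_
    linear_combination hd₁ - D1 - 2 * (a₂ ^ 2 - a₃ ^ 2) * hc₁ - 2 * (a₃ ^ 2 - a₁ ^ 2) * hc₂
  have hn3 : n₃ = 0 := by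
    refine (mul_eq_zero.1 (?_ : n₃ * (a₁ ^ 2 - a₂ ^ 2) = 0)).resolve_right t12
    linear_combination o1 - o2 + (c₁ - c₂) * D1
  have hn1 : n₁ = 0 := by linear_combination o1 + c₁ * D1 - a₁ ^ 2 * hn3
  rw [hc₁] at q1
  rw [hc₂] at q2
  rw [hc₃] at q3
  have e12 : (n₂ - k₀ * d₂ - k₁ * d₀) + (n₄ - k₁ * d₂) * (a₁ ^ 2 + a₂ ^ 2) = 0 := by
    refine (mul_eq_zero.1 ?_).resolve_left t12
    linear_combination q1 - q2
  have e13 : (n₂ - k₀ * d₂ - k₁ * d₀) + (n₄ - k₁ * d₂) * (a₁ ^ 2 + a₃ ^ 2) = 0 := by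
    refine (mul_eq_zero.1 ?_).resolve_left t13
    linear_combination q1 - q3
  have hn4 : n₄ = k₁ * d₂ := by
    refine sub_eq_zero.1 ((mul_eq_zero.1 ?_).resolve_left t23)
    linear_combination e12 - e13
  have hn2 : n₂ = k₀ * d₂ + k₁ * d₀ := by
    linear_combination e12 - (a₁ ^ 2 + a₂ ^ 2) * hn4
  have hn0 : n₀ = k₀ * d₀ := by
    linear_combination q1 - a₁ ^ 2 * hn2 - a₁ ^ 4 * hn4
  have hND : ∀ x, N x = (k₀ + k₁ * x ^ 2) * D x := by
    intro x
    rw [hN, hD]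
    linear_combination hn0 + x * hn1 + x ^ 2 * hn2 + x ^ 3 * hn3 + x ^ 4 * hn4 + x ^ 5 * hn5 -
      (k₀ + k₁ * x ^ 2) * x * D1
  have hDR : ∀ x ∈ R, D x = 0 := by
    intro x hx
    by_contra hDx
    obtain ⟨y, z, e1, e2, e3, hne⟩ := hpt x hx
    have hzx : z = k₀ + k₁ * x ^ 2 :=
      mul_right_cancel₀ hDx ((hz x y z e1 e2 e3).trans (hND x))
    refine hne ?_
    rw [hzx, hc₁, hc₂]
    ring
  obtain ⟨x, hx, x', hx', hxx'⟩ := Finset.one_lt_card.1 (show 1 < R.card by omega)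
  have hd2 : d₂ = 0 := by
    have e := hDR x hx
    have e' := hDR x' hx'
    rw [hD] at e e'
    refine (mul_eq_zero.1 (?_ : d₂ * ((x - x') * (x + x')) = 0)).resolve_right
      (mul_ne_zero (sub_ne_zero.2 hxx') (hRadd x hx x' hx'))
    linear_combination e - e' - (x - x') * D1
  have hd0 : d₀ = 0 := by
    have e := hDR x hx
    rw [hD] at e
    linear_combination e - x * D1 - x ^ 2 * hd2
  have hk1 : k₁ = 0 := by
    refine (mul_eq_zero.1 (?_ : k₁ * (2 * ((a₁ - a₂) * (a₁ - a₃) * (a₂ - a₃))) = 0)).resolve_right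
      (mul_ne_zero h2 (mul_ne_zero (mul_ne_zero d12 d13) d23))
    linear_combination hd2 - hd₂ - 2 * (a₂ - a₃) * hc₁ - 2 * (a₃ - a₁) * hc₂ -
      2 * (a₁ - a₂) * hc₃
  have hN0 : ∀ x, N x = 0 := fun x => by
    rw [hND, hD, hd0, D1, hd2]
    ring
  rw [hk1, zero_mul, add_zero] at hc₁ hc₂ hc₃
  have hb23 : b₂ = b₃ := by
    refine sub_eq_zero.1 ((mul_eq_zero.1 (?_ : ((a₁ - a₂) * (a₁ + a₂) ^ 2) *
      ((a₁ - a₃) * (a₁ + a₃) ^ 2) * (b₂ - b₃) = 0)).resolve_left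
      (mul_ne_zero (mul_ne_zero d12 (pow_ne_zero _ s12)) (mul_ne_zero d13 (pow_ne_zero _ s13))))
    have e := hN0 a₁
    rw [hN, hn₀, hn₁, hn₂, hn₃, hn₄, hn₅, hc₁, hc₂, hc₃] at e
    linear_combination e
  have hb13 : b₁ = b₃ := by
    refine sub_eq_zero.1 ((mul_eq_zero.1 (?_ : ((a₁ - a₂) * (a₁ + a₂) ^ 2) *
      ((a₂ - a₃) * (a₂ + a₃) ^ 2) * (b₁ - b₃) = 0)).resolve_left
      (mul_ne_zero (mul_ne_zero d12 (pow_ne_zero _ s12)) (mul_ne_zero d23 (pow_ne_zero _ s23))))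
    have e := hN0 a₂
    rw [hN, hn₀, hn₁, hn₂, hn₃, hn₄, hn₅, hc₁, hc₂, hc₃] at e
    linear_combination e
  obtain ⟨y, z, e1, e2, e3, hne⟩ := hpt x hx
  rw [hc₁, hc₂] at hne
  rw [hc₁, hb13] at e1
  rw [hc₂, hb23] at e2
  rw [hc₃] at e3
  by_cases hy : y - b₃ = 0
  · rw [hy, mul_zero] at e1
    have hzk : z - k₀ = 0 := pow_eq_zero_iff two_ne_zero |>.1 e1.symm
    exact hne (by rw [hzk, zero_mul, zero_mul])
  · refine h4 x hx (add_add_add_eq_zero_of_cubicForm_eq h12 h13 h23 ?_ ?_)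
    · exact mul_right_cancel₀ hy (e1.trans e2.symm)
    · exact mul_right_cancel₀ hy (e1.trans e3.symm)

theorem cubicForm_ne_zero {F : Type*} [Field F] {a x : F} (h : x ≠ a) (h' : x + a ≠ 0) :
    cubicForm a x ≠ 0 :=
  mul_ne_zero (sub_ne_zero.2 h) (pow_ne_zero _ h')

/-- Two solutions with the same parameter `a` determine `z` as a function of `x`. -/
theorem ne_and_two_mul_eq_of_same_parameter {F : Type*} [Field F] {a b₁ b₂ c₁ c₂ x y z : F}
    (hr : cubicForm a x ≠ 0) (hne : ¬ (b₁ = b₂ ∧ c₁ = c₂))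
    (e₁ : cubicForm a x * (y - b₁) = (z - c₁) ^ 2)
    (e₂ : cubicForm a x * (y - b₂) = (z - c₂) ^ 2) :
    c₂ - c₁ ≠ 0 ∧ 2 * z = c₁ + c₂ + (b₂ - b₁) / (c₂ - c₁) * cubicForm a x := by
  have h : c₂ - c₁ ≠ 0 := by
    intro hc
    refine hne ⟨?_, (sub_eq_zero.1 hc).symm⟩
    rw [sub_eq_zero.1 hc] at e₂
    have := mul_left_cancel₀ hr (e₁.trans e₂.symm)
    linear_combination -this
  refine ⟨h, ?_⟩
  field_simp
  linear_combination e₂ - e₁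

open Polynomial in
theorem false_of_two_equal_parameters {F : Type*} [Field F] {R : Finset F} (hR : 13 ≤ R.card)
    {a a₃ b₁ b₂ b₃ c₁ c₂ c₃ : F} (h3 : a ≠ a₃) (s3 : a + a₃ ≠ 0)
    (hne : ¬ (b₁ = b₂ ∧ c₁ = c₂)) (hr : ∀ x ∈ R, cubicForm a x ≠ 0)
    (hpt : ∀ x ∈ R, ∃ y z, cubicForm a x * (y - b₁) = (z - c₁) ^ 2 ∧
      cubicForm a x * (y - b₂) = (z - c₂) ^ 2 ∧ cubicForm a₃ x * (y - b₃) = (z - c₃) ^ 2) :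
    False := by
  obtain ⟨k, hk⟩ : ∃ k, k = (b₂ - b₁) / (c₂ - c₁) := ⟨_, rfl⟩
  let ρ : F → F[X] := fun t => (X - C t) * (X + C t) ^ 2
  let P : F[X] := ρ a₃ * (C (c₂ - c₁) + C k * ρ a) ^ 2 -
    ρ a * (C (c₁ + c₂ - 2 * c₃) + C k * ρ a) ^ 2 - C (4 * (b₃ - b₁)) * ρ a * ρ a₃
  have hρ : ∀ t, (ρ t).natDegree ≤ 3 := fun t => by simp only [ρ]; compute_degree
  have hlin : ∀ u : F, ((C u + C k * ρ a) ^ 2).natDegree ≤ 6 := fun u =>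
    natDegree_pow_le_of_le (m := 3) 2 ((natDegree_add_le _ _).trans (max_le (by simp)
      ((natDegree_C_mul_le _ _).trans (hρ a))))
  have hP : P.natDegree ≤ 9 := by
    refine (natDegree_sub_le _ _).trans (max_le ((natDegree_sub_le _ _).trans (max_le ?_ ?_)) ?_)
    · exact natDegree_mul_le_of_le (m := 3) (n := 6) (hρ _) (hlin _)
    · exact natDegree_mul_le_of_le (m := 3) (n := 6) (hρ _) (hlin _)
    · exact (natDegree_mul_le_of_le (m := 3) (n := 3)
        ((natDegree_C_mul_le _ _).trans (hρ _)) (hρ _)).trans (by norm_num)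
  have hρe : ∀ t x, (ρ t).eval x = cubicForm t x := fun t x => by simp [ρ, cubicForm]
  have heval : ∀ x, P.eval x = cubicForm a₃ x * ((c₂ - c₁) + k * cubicForm a x) ^ 2 -
      cubicForm a x * ((c₁ + c₂ - 2 * c₃) + k * cubicForm a x) ^ 2 -
      4 * (b₃ - b₁) * cubicForm a x * cubicForm a₃ x := fun x => by
    simp only [P, eval_add, eval_sub, eval_mul, eval_pow, eval_C, hρe]
  have hP0 : P = 0 := by
    refine eq_zero_of_natDegree_lt_card_of_eval_eq_zero' P R (fun x hx => ?_) (by omega)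
    obtain ⟨y, z, e₁, e₂, e₃⟩ := hpt x hx
    obtain ⟨-, hz⟩ := ne_and_two_mul_eq_of_same_parameter (hr x hx) hne e₁ e₂
    rw [← hk] at hz
    have h1 : c₂ - c₁ + k * cubicForm a x = 2 * (z - c₁) := by linear_combination -hz
    have h3 : c₁ + c₂ - 2 * c₃ + k * cubicForm a x = 2 * (z - c₃) := by linear_combination -hz
    rw [heval, h1, h3]
    linear_combination 4 * cubicForm a x * e₃ - 4 * cubicForm a₃ x * e₁
  obtain ⟨x, hx⟩ : R.Nonempty := Finset.card_pos.1 (by omega)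
  obtain ⟨y, z, e₁, e₂, -⟩ := hpt x hx
  obtain ⟨hc, -⟩ := ne_and_two_mul_eq_of_same_parameter (hr x hx) hne e₁ e₂
  have h0 := heval a
  have ha : cubicForm a a = 0 := by simp [cubicForm]
  rw [hP0, eval_zero, ha] at h0
  refine mul_ne_zero (cubicForm_ne_zero h3 s3) (pow_ne_zero 2 hc) ?_
  linear_combination -h0

open Polynomial in
theorem false_of_equal_parameters {F : Type*} [Field F] {R : Finset F} (hR : 13 ≤ R.card)
    {a b₁ b₂ b₃ c₁ c₂ c₃ : F} (h12 : ¬ (b₁ = b₂ ∧ c₁ = c₂)) (h13 : ¬ (b₁ = b₃ ∧ c₁ = c₃))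
    (h23 : ¬ (b₂ = b₃ ∧ c₂ = c₃)) (hr : ∀ x ∈ R, cubicForm a x ≠ 0)
    (hpt : ∀ x ∈ R, ∃ y z, cubicForm a x * (y - b₁) = (z - c₁) ^ 2 ∧
      cubicForm a x * (y - b₂) = (z - c₂) ^ 2 ∧ cubicForm a x * (y - b₃) = (z - c₃) ^ 2) :
    False := by
  obtain ⟨k, hk⟩ : ∃ k, k = (b₂ - b₁) / (c₂ - c₁) - (b₃ - b₁) / (c₃ - c₁) := ⟨_, rfl⟩
  let P : F[X] := C (c₂ - c₃) + C k * ((X - C a) * (X + C a) ^ 2)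
  have hP : P.natDegree ≤ 3 := by simp only [P]; compute_degree
  have heval : ∀ x, P.eval x = c₂ - c₃ + k * cubicForm a x := fun x => by simp [P, cubicForm]
  have hP0 : P = 0 := by
    refine eq_zero_of_natDegree_lt_card_of_eval_eq_zero' P R (fun x hx => ?_) (by omega)
    obtain ⟨y, z, e₁, e₂, e₃⟩ := hpt x hx
    obtain ⟨-, hz⟩ := ne_and_two_mul_eq_of_same_parameter (hr x hx) h12 e₁ e₂
    obtain ⟨-, hz'⟩ := ne_and_two_mul_eq_of_same_parameter (hr x hx) h13 e₁ e₃
    rw [heval, hk]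
    linear_combination hz' - hz
  obtain ⟨x, hx⟩ : R.Nonempty := Finset.card_pos.1 (by omega)
  obtain ⟨y, z, -, e₂, e₃⟩ := hpt x hx
  obtain ⟨hc, -⟩ := ne_and_two_mul_eq_of_same_parameter (hr x hx) h23 e₂ e₃
  have h0 := heval a
  have ha : cubicForm a a = 0 := by simp [cubicForm]
  rw [hP0, eval_zero, ha] at h0
  exact hc (by linear_combination h0)

/-- A quadratic identity with three distinct roots forces the two parameters to agree. -/
theorem eq_of_three_common_points {F : Type*} [Field F] (h2 : (2 : F) ≠ 0)
    {r₁ r₂ b₁ b₂ c₁ c₂ y₁ y₂ y₃ z₁ z₂ z₃ : F} (hr₁ : r₁ ≠ 0) (hr₂ : r₂ ≠ 0)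
    (h12 : z₁ ≠ z₂) (h13 : z₁ ≠ z₃) (h23 : z₂ ≠ z₃)
    (e₁ : r₁ * (y₁ - b₁) = (z₁ - c₁) ^ 2) (e₁' : r₂ * (y₁ - b₂) = (z₁ - c₂) ^ 2)
    (e₂ : r₁ * (y₂ - b₁) = (z₂ - c₁) ^ 2) (e₂' : r₂ * (y₂ - b₂) = (z₂ - c₂) ^ 2)
    (e₃ : r₁ * (y₃ - b₁) = (z₃ - c₁) ^ 2) (e₃' : r₂ * (y₃ - b₂) = (z₃ - c₂) ^ 2) :
    r₁ = r₂ ∧ b₁ = b₂ ∧ c₁ = c₂ := by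
  have g₁₂ : (r₂ - r₁) * (z₁ + z₂) = 2 * (r₂ * c₁ - r₁ * c₂) := by
    refine mul_left_cancel₀ (sub_ne_zero.2 h12) ?_
    linear_combination r₁ * (e₁' - e₂') - r₂ * (e₁ - e₂)
  have g₁₃ : (r₂ - r₁) * (z₁ + z₃) = 2 * (r₂ * c₁ - r₁ * c₂) := by
    refine mul_left_cancel₀ (sub_ne_zero.2 h13) ?_
    linear_combination r₁ * (e₁' - e₃') - r₂ * (e₁ - e₃)
  have hr : r₁ = r₂ := by
    refine (sub_eq_zero.1 ((mul_eq_zero.1 (?_ : (r₂ - r₁) * (z₂ - z₃) = 0)).resolve_right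
      (sub_ne_zero.2 h23))).symm
    linear_combination g₁₂ - g₁₃
  subst hr
  have hc : c₁ = c₂ := by
    refine mul_left_cancel₀ (mul_ne_zero h2 hr₁) ?_
    linear_combination -g₁₂
  subst hc
  refine ⟨rfl, ?_, rfl⟩
  have := mul_left_cancel₀ hr₁ (e₁.trans e₁'.symm)
  linear_combination -this

end Algebra

section Construction

theorem false_of_common_solutions {F : Type*} [Field F] {X : Set F}
    (hX : ∀ u ∈ X, ∀ v ∈ X, ∀ w ∈ X, ∀ s ∈ X, u + v + w + s ≠ 0)
    {a b c : Fin 3 → F} {x y z : Fin 25 → F}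
    (hA : Function.Injective fun i => (a i, b i, c i))
    (hB : Function.Injective fun j => (x j, y j, z j))
    (haX : ∀ i, a i ∈ X) (hxX : ∀ j, x j ∈ X) (hxa : ∀ i j, x j ≠ a i)
    (he : ∀ i j, cubicForm (a i) (x j) * (y j - b i) = (z j - c i) ^ 2)
    (hne : ∀ i i' j, i ≠ i' →
      (z j - c i) * (x j ^ 2 - a i' ^ 2) ≠ (z j - c i') * (x j ^ 2 - a i ^ 2)) : False := by
  classical
  have hadd : ∀ u ∈ X, ∀ v ∈ X, u + v ≠ 0 := fun u hu v hv h =>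
    hX u hu v hv u hu v hv (by linear_combination 2 * h)
  have hzero : ∀ u ∈ X, u ≠ 0 := fun u hu h => hadd u hu u hu (by rw [h, add_zero])
  have h2 : (2 : F) ≠ 0 := fun h => hadd _ (haX 0) _ (haX 0) (by linear_combination a 0 * h)
  have hr : ∀ i j, cubicForm (a i) (x j) ≠ 0 := fun i j =>
    cubicForm_ne_zero (hxa i j) (hadd _ (hxX j) _ (haX i))
  have hAne : ∀ i i', i ≠ i' → a i = a i' → ¬ (b i = b i' ∧ c i = c i') := by
    rintro i i' hii ha ⟨hb, hc⟩
    exact hii (hA (by simp [ha, hb, hc]))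
  have hfib : ∀ u ∈ Finset.univ.image x, (Finset.univ.filter fun j => x j = u).card ≤ 2 := by
    intro u _
    by_contra! hcard
    obtain ⟨j₁, m₁, j₂, m₂, j₃, m₃, n₁₂, n₁₃, n₂₃⟩ := Finset.two_lt_card.1 hcard
    simp only [Finset.mem_filter, Finset.mem_univ, true_and] at m₁ m₂ m₃
    have hzne : ∀ j j', j ≠ j' → x j = u → x j' = u → z j ≠ z j' := by
      intro j j' hj hju hju' hz
      refine hj (hB ?_)
      have e := he 0 j
      have e' := he 0 j'
      rw [hju', ← hju, ← hz] at e'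
      have := mul_left_cancel₀ (hr 0 j) (e.trans e'.symm)
      simp [hju, hju', hz, sub_left_inj.1 this]
    have hall : ∀ i i', cubicForm (a i) u = cubicForm (a i') u ∧ b i = b i' ∧ c i = c i' := by
      intro i i'
      refine eq_of_three_common_points h2 (m₁ ▸ hr i j₁) (m₁ ▸ hr i' j₁) (hzne _ _ n₁₂ m₁ m₂)
        (hzne _ _ n₁₃ m₁ m₃) (hzne _ _ n₂₃ m₂ m₃) (y₁ := y j₁) (y₂ := y j₂) (y₃ := y j₃)
        ?_ ?_ ?_ ?_ ?_ ?_
      · exact m₁ ▸ he i j₁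
      · exact m₁ ▸ he i' j₁
      · exact m₂ ▸ he i j₂
      · exact m₂ ▸ he i' j₂
      · exact m₃ ▸ he i j₃
      · exact m₃ ▸ he i' j₃
    have ha : ∀ i i', i ≠ i' → a i ≠ a i' := fun i i' hii h => hAne i i' hii h (hall i i').2
    refine hX u (m₁ ▸ hxX j₁) _ (haX 0) _ (haX 1) _ (haX 2) ?_
    exact add_add_add_eq_zero_of_cubicForm_eq (ha 0 1 (by decide)) (ha 0 2 (by decide))
      (ha 1 2 (by decide)) (hall 0 1).1 (hall 0 2).1
  obtain ⟨R, hRdef⟩ : ∃ R, R = Finset.univ.image x := ⟨_, rfl⟩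
  have hR : 13 ≤ R.card := by
    have := Finset.card_le_mul_card_image (f := x) Finset.univ 2 hfib
    rw [Finset.card_univ, Fintype.card_fin, ← hRdef] at this
    omega
  have hRmem : ∀ u ∈ R, ∃ j, x j = u := by simp [hRdef]
  have two_equal : ∀ i i' i'', i ≠ i' → a i = a i' → a i ≠ a i'' → False := by
    intro i i' i'' hii h h'
    refine false_of_two_equal_parameters hR (b₃ := b i'') (c₃ := c i'') h'
      (hadd _ (haX _) _ (haX _)) (hAne i i' hii h) ?_ ?_
    · intro u hu
      obtain ⟨j, rfl⟩ := hRmem u hu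
      exact hr i j
    · intro u hu
      obtain ⟨j, rfl⟩ := hRmem u hu
      refine ⟨y j, z j, he i j, ?_, he i'' j⟩
      rw [h]
      exact he i' j
  by_cases h01 : a 0 = a 1
  · by_cases h02 : a 0 = a 2
    · refine false_of_equal_parameters hR (hAne 0 1 (by decide) h01) (hAne 0 2 (by decide) h02)
        (hAne 1 2 (by decide) (h01.symm.trans h02)) (a := a 0) ?_ ?_
      · intro u hu
        obtain ⟨j, rfl⟩ := hRmem u hu
        exact hr 0 j
      · intro u hu
        obtain ⟨j, rfl⟩ := hRmem u hu
        exact ⟨y j, z j, he 0 j, h01 ▸ he 1 j, h02 ▸ he 2 j⟩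
    · exact two_equal 0 1 2 (by decide) h01 h02
  · by_cases h02 : a 0 = a 2
    · exact two_equal 0 2 1 (by decide) h02 h01
    · by_cases h12 : a 1 = a 2
      · exact two_equal 1 2 0 (by decide) h12 (Ne.symm h01)
      · refine false_of_distinct_parameters hR h01 h02 h12 h2 (hzero _ (haX _)) (hzero _ (haX _))
          (hzero _ (haX _)) (hadd _ (haX _) _ (haX _)) (hadd _ (haX _) _ (haX _))
          (hadd _ (haX _) _ (haX _)) ?_ ?_ ?_ (b₁ := b 0) (b₂ := b 1) (b₃ := b 2) (c₁ := c 0)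
          (c₂ := c 1) (c₃ := c 2)
        · intro u hu v hv
          obtain ⟨j, rfl⟩ := hRmem u hu
          obtain ⟨j', rfl⟩ := hRmem v hv
          exact hadd _ (hxX _) _ (hxX _)
        · intro u hu
          obtain ⟨j, rfl⟩ := hRmem u hu
          exact hX _ (hxX _) _ (haX _) _ (haX _) _ (haX _)
        · intro u hu
          obtain ⟨j, rfl⟩ := hRmem u hu
          exact ⟨y j, z j, he 0 j, he 1 j, he 2 j, hne 0 1 j (by decide)⟩

/-- The graph on `F³` in which distinct `(x, y, z)` and `(x', y', z')` with `x, x' ∈ X` are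
adjacent when `y + z' = x x' ^ 2` and `z + y' = x ^ 2 x'`. -/
def momentGraph {F : Type*} [Field F] (X : Set F) : SimpleGraph (F × F × F) where
  Adj v w := v ≠ w ∧ v.1 ∈ X ∧ w.1 ∈ X ∧ v.2.1 + w.2.2 = v.1 * w.1 ^ 2 ∧
    v.2.2 + w.2.1 = v.1 ^ 2 * w.1
  symm := ⟨fun v w ⟨h, hv, hw, e, e'⟩ => ⟨h.symm, hw, hv, by linear_combination e',
    by linear_combination e⟩⟩
  loopless := ⟨fun _ h => h.1 rfl⟩

theorem ksub_adj_left (i : Fin 3) (j : Fin 25) :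
    KsubThreeTwentyFive.Adj (Sum.inl i) (Sum.inr (Sum.inr (i, j))) := by
  simp [KsubThreeTwentyFive]

theorem ksub_adj_right (i : Fin 3) (j : Fin 25) :
    KsubThreeTwentyFive.Adj (Sum.inr (Sum.inl j)) (Sum.inr (Sum.inr (i, j))) := by
  simp [KsubThreeTwentyFive]

theorem momentGraph_not_containsCopy {F : Type*} [Field F] {X : Set F}
    (hX : ∀ u ∈ X, ∀ v ∈ X, ∀ w ∈ X, ∀ s ∈ X, u + v + w + s ≠ 0) :
    ¬ ContainsCopy (momentGraph X) KsubThreeTwentyFive := by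
  rintro ⟨f, hf, hadj⟩
  obtain ⟨A, hA⟩ : ∃ A : Fin 3 → F × F × F, ∀ i, f (Sum.inl i) = A i := ⟨_, fun _ => rfl⟩
  obtain ⟨B, hB⟩ : ∃ B : Fin 25 → F × F × F, ∀ j, f (Sum.inr (Sum.inl j)) = B j :=
    ⟨_, fun _ => rfl⟩
  obtain ⟨T, hT⟩ : ∃ T : Fin 3 → Fin 25 → F × F × F, ∀ i j,
    f (Sum.inr (Sum.inr (i, j))) = T i j := ⟨fun i j => f (Sum.inr (Sum.inr (i, j))),
      fun _ _ => rfl⟩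
  have hAT : ∀ i j, (momentGraph X).Adj (A i) (T i j) := fun i j => by
    rw [← hA, ← hT]; exact hadj _ _ (ksub_adj_left i j)
  have hBT : ∀ i j, (momentGraph X).Adj (B j) (T i j) := fun i j => by
    rw [← hB, ← hT]; exact hadj _ _ (ksub_adj_right i j)
  have hAinj : Function.Injective A := fun i i' h => by
    rw [← hA, ← hA] at h
    exact Sum.inl_injective (hf h)
  have hBinj : Function.Injective B := fun j j' h => by
    rw [← hB, ← hB] at h
    exact Sum.inl_injective (Sum.inr_injective (hf h))
  have hAB : ∀ i j, A i ≠ B j := fun i j h => by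
    rw [← hA, ← hB] at h
    exact Sum.inl_ne_inr (hf h)
  have hTne : ∀ i i' j, i ≠ i' → T i j ≠ T i' j := fun i i' j hii h => by
    rw [← hT, ← hT] at h
    exact hii (congrArg Prod.fst (Sum.inr_injective (Sum.inr_injective (hf h))))
  have hy : ∀ i j, (B j).2.1 - (A i).2.1 = ((B j).1 - (A i).1) * (T i j).1 ^ 2 := fun i j => by
    linear_combination (hBT i j).2.2.2.1 - (hAT i j).2.2.2.1
  have hz : ∀ i j, (B j).2.2 - (A i).2.2 = ((B j).1 ^ 2 - (A i).1 ^ 2) * (T i j).1 := fun i j => by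
    linear_combination (hBT i j).2.2.2.2 - (hAT i j).2.2.2.2
  have hxa : ∀ i j, (B j).1 ≠ (A i).1 := fun i j h => by
    have e := hy i j
    have e' := hz i j
    rw [h, sub_self, zero_mul, sub_eq_zero] at e e'
    exact hAB i j (Prod.ext h.symm (Prod.ext e.symm e'.symm))
  refine false_of_common_solutions hX (a := fun i => (A i).1) (b := fun i => (A i).2.1)
    (c := fun i => (A i).2.2) (x := fun j => (B j).1) (y := fun j => (B j).2.1)
    (z := fun j => (B j).2.2) hAinj hBinj (fun i => (hAT i 0).2.1) (fun j => (hBT 0 j).2.1) hxa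
    ?_ ?_
  · intro i j
    simp only [hy i j, hz i j, cubicForm]
    ring
  · intro i i' j hii h
    have hne : ∀ k, (B j).1 ^ 2 - (A k).1 ^ 2 ≠ 0 := by
      intro k
      rw [sq_sub_sq]
      have hb := (hBT 0 j).2.1
      have ha := (hAT k j).2.1
      refine mul_ne_zero (fun h => hX _ hb _ ha _ hb _ ha ?_) (sub_ne_zero.2 (hxa k j))
      linear_combination 2 * h
    simp only [hz i j, hz i' j] at h
    have ht : (T i j).1 = (T i' j).1 := by
      refine mul_left_cancel₀ (mul_ne_zero (hne i) (hne i')) ?_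
      linear_combination h
    refine hTne i i' j hii (Prod.ext ht (Prod.ext ?_ ?_))
    · have e := (hBT i j).2.2.2.2
      rw [ht, ← (hBT i' j).2.2.2.2] at e
      exact add_left_cancel e
    · have e := (hBT i j).2.2.2.1
      rw [ht, ← (hBT i' j).2.2.2.1] at e
      exact add_left_cancel e

theorem card_sub_one_le_degree_momentGraph {F : Type*} [Field F] [Fintype F] (X : Finset F)
    [DecidableRel (momentGraph (X : Set F)).Adj] {v : F × F × F} (hv : v.1 ∈ X) :
    X.card - 1 ≤ (momentGraph (X : Set F)).degree v := by
  classical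
  let g : F → F × F × F := fun t => (t, v.1 ^ 2 * t - v.2.2, v.1 * t ^ 2 - v.2.1)
  have hg : Function.Injective g := fun t t' h => congrArg Prod.fst h
  rw [← Finset.card_image_of_injective X hg, ← SimpleGraph.card_neighborFinset_eq_degree]
  refine (Finset.pred_card_le_card_erase (a := v)).trans (Finset.card_le_card fun w hw => ?_)
  obtain ⟨hwv, hw⟩ := Finset.mem_erase.1 hw
  obtain ⟨t, ht, rfl⟩ := Finset.mem_image.1 hw
  rw [SimpleGraph.mem_neighborFinset]
  exact ⟨hwv.symm, hv, ht, by simp [g], by simp [g]⟩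

theorem card_mul_le_two_mul_ncard_edgeSet_momentGraph {F : Type*} [Field F] [Fintype F]
    (X : Finset F) : X.card * Fintype.card F ^ 2 * (X.card - 1) ≤
      2 * (momentGraph (X : Set F)).edgeSet.ncard := by
  classical
  rw [← SimpleGraph.coe_edgeFinset, Set.ncard_coe_finset,
    ← SimpleGraph.sum_degrees_eq_twice_card_edges]
  have hcard : (X ×ˢ (Finset.univ : Finset (F × F))).card = X.card * Fintype.card F ^ 2 := by
    rw [Finset.card_product, Finset.card_univ, Fintype.card_prod, sq]
  rw [← hcard, ← smul_eq_mul]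
  refine (Finset.card_nsmul_le_sum _ _ _ fun v hv => ?_).trans
    (Finset.sum_le_sum_of_subset (Finset.subset_univ _))
  exact card_sub_one_le_degree_momentGraph X (Finset.mem_product.1 hv).1

theorem ContainsCopy.of_map {α γ : Type*} {G : SimpleGraph α} (φ : α ↪ γ)
    (h : ContainsCopy (G.map φ) KsubThreeTwentyFive) : ContainsCopy G KsubThreeTwentyFive := by
  obtain ⟨f, hf, hadj⟩ := h
  have hrange : ∀ v, ∃ u, φ u = f v := by
    have key : ∀ v w, KsubThreeTwentyFive.Adj v w → (∃ u, φ u = f v) ∧ ∃ u, φ u = f w := by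
      intro v w hvw
      obtain ⟨u, u', -, hu, hu'⟩ := (SimpleGraph.map_adj φ G _ _).1 (hadj v w hvw)
      exact ⟨⟨u, hu⟩, ⟨u', hu'⟩⟩
    rintro (i | j | ⟨i, j⟩)
    · exact (key _ _ (ksub_adj_left i 0)).1
    · exact (key _ _ (ksub_adj_right 0 j)).1
    · exact (key _ _ (ksub_adj_left i j)).2
  choose g hg using hrange
  refine ⟨g, fun v w h => hf ?_, fun v w hvw => ?_⟩
  · rw [← hg, ← hg, h]
  · have := hadj v w hvw
    rwa [← hg, ← hg, SimpleGraph.map_adj_apply] at this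

theorem exists_finset_zmod (p : ℕ) [Fact p.Prime] : ∃ X : Finset (ZMod p),
    X.card = (p - 1) / 4 ∧ ∀ u ∈ X, ∀ v ∈ X, ∀ w ∈ X, ∀ s ∈ X, u + v + w + s ≠ 0 := by
  classical
  have hp : 0 < p := (Fact.out : p.Prime).pos
  refine ⟨(Finset.Icc 1 ((p - 1) / 4)).image fun m : ℕ => (m : ZMod p), ?_, ?_⟩
  · rw [Finset.card_image_of_injOn, Nat.card_Icc, Nat.add_sub_cancel]
    intro m hm m' hm' h
    rw [Finset.mem_coe, Finset.mem_Icc] at hm hm'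
    have h' := (ZMod.natCast_eq_natCast_iff' m m' p).1 h
    rwa [Nat.mod_eq_of_lt (by omega), Nat.mod_eq_of_lt (by omega)] at h'
  · simp only [Finset.mem_image, Finset.mem_Icc]
    rintro _ ⟨u, hu, rfl⟩ _ ⟨v, hv, rfl⟩ _ ⟨w, hw, rfl⟩ _ ⟨s, hs, rfl⟩ h
    have h' : ((u + v + w + s : ℕ) : ZMod p) = 0 := by push_cast; exact h
    have := Nat.le_of_dvd (by omega) ((ZMod.natCast_eq_zero_iff _ _).1 h')
    omega

theorem exists_copy_free_of_prime {p n : ℕ} (hp : p.Prime) (hp16 : 16 ≤ p) (hpn : p ^ 3 ≤ n) :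
    ∃ G : SimpleGraph (Fin n), ¬ ContainsCopy G KsubThreeTwentyFive ∧
      p ^ 4 ≤ 128 * G.edgeSet.ncard := by
  have : Fact p.Prime := ⟨hp⟩
  obtain ⟨X, hcard, hX⟩ := exists_finset_zmod p
  have hF : Fintype.card (ZMod p × ZMod p × ZMod p) ≤ Fintype.card (Fin n) := by
    rw [Fintype.card_prod, Fintype.card_prod, ZMod.card, Fintype.card_fin]
    refine le_trans (le_of_eq ?_) hpn
    ring
  obtain ⟨φ⟩ := Function.Embedding.nonempty_of_card_le hF
  refine ⟨(momentGraph (X : Set (ZMod p))).map φ, fun h =>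
    momentGraph_not_containsCopy (X := (X : Set (ZMod p))) hX h.of_map, ?_⟩
  rw [SimpleGraph.edgeSet_map, Set.ncard_image_of_injective _ φ.sym2Map.injective]
  have h := card_mul_le_two_mul_ncard_edgeSet_momentGraph X
  rw [ZMod.card, hcard] at h
  have h1 : p ≤ 8 * ((p - 1) / 4 - 1) := by omega
  have h2 : p ≤ 8 * ((p - 1) / 4) := by omega
  calc p ^ 4 = p * p ^ 2 * p := by ring
    _ ≤ (8 * ((p - 1) / 4)) * p ^ 2 * (8 * ((p - 1) / 4 - 1)) := by gcongr
    _ = 64 * ((p - 1) / 4 * p ^ 2 * ((p - 1) / 4 - 1)) := by ring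
    _ ≤ 64 * (2 * _) := Nat.mul_le_mul_left _ h
    _ = _ := by ring

theorem exists_copy_free_graph {n : ℕ} (hn : 32 ^ 3 ≤ n) :
    ∃ G : SimpleGraph (Fin n), ¬ ContainsCopy G KsubThreeTwentyFive ∧
      1 / 2048 * (n : ℝ) ^ ((4 : ℝ) / 3) ≤ (G.edgeSet.ncard : ℝ) := by
  obtain ⟨k, hk, hk'⟩ : ∃ k, (2 * k) ^ 3 ≤ n ∧ n < (2 * (k + 1)) ^ 3 := by
    let k := Nat.findGreatest (fun k => (2 * k) ^ 3 ≤ n) n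
    refine ⟨k, Nat.findGreatest_spec (P := fun k => (2 * k) ^ 3 ≤ n) (Nat.zero_le n) (by simp),
      ?_⟩
    by_contra! h
    have hle : k + 1 ≤ n := by
      have : k + 1 ≤ (2 * (k + 1)) ^ 3 := by nlinarith [sq_nonneg k]
      omega
    have := Nat.le_findGreatest (P := fun k => (2 * k) ^ 3 ≤ n) hle h
    omega
  have hk16 : 16 ≤ k := by
    by_contra! h
    have : (2 * (k + 1)) ^ 3 ≤ 32 ^ 3 := Nat.pow_le_pow_left (by omega) 3
    omega
  obtain ⟨p, hp, hkp, hpk⟩ := Nat.exists_prime_lt_and_le_two_mul k (by omega)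
  obtain ⟨G, hG, hcard⟩ := exists_copy_free_of_prime hp (by omega)
    ((Nat.pow_le_pow_left hpk 3).trans hk)
  refine ⟨G, hG, ?_⟩
  have hn3 : (n : ℝ) ≤ (2 * p : ℝ) ^ (3 : ℝ) := by
    have : n ≤ (2 * p) ^ 3 := hk'.le.trans (Nat.pow_le_pow_left (by omega) 3)
    rw [show (3 : ℝ) = ((3 : ℕ) : ℝ) by norm_num, Real.rpow_natCast]
    exact_mod_cast this
  have hn4 : (n : ℝ) ^ ((4 : ℝ) / 3) ≤ 16 * (p : ℝ) ^ 4 := by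
    calc (n : ℝ) ^ ((4 : ℝ) / 3) ≤ ((2 * p : ℝ) ^ (3 : ℝ)) ^ ((4 : ℝ) / 3) := by gcongr
      _ = (2 * p : ℝ) ^ ((4 : ℕ) : ℝ) := by
        rw [← Real.rpow_mul (by positivity)]
        norm_num
      _ = 16 * (p : ℝ) ^ 4 := by rw [Real.rpow_natCast]; ring
  have hp4 : (p : ℝ) ^ 4 ≤ 128 * (G.edgeSet.ncard : ℝ) := by exact_mod_cast hcard
  linarith

end Construction

theorem stmt_9 :
    ∃ c1 c2 : ℝ, 0 < c1 ∧ 0 < c2 ∧ ∃ n0 : ℕ, ∀ n : ℕ, n0 ≤ n →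
      (∀ G : SimpleGraph (Fin n), ¬ ContainsCopy G KsubThreeTwentyFive →
        (G.edgeSet.ncard : ℝ) ≤ c2 * (n : ℝ) ^ ((4 : ℝ) / 3)) ∧
      (∃ G : SimpleGraph (Fin n), ¬ ContainsCopy G KsubThreeTwentyFive ∧
        c1 * (n : ℝ) ^ ((4 : ℝ) / 3) ≤ (G.edgeSet.ncard : ℝ)) := by
  obtain ⟨c, hc, hupper⟩ := exists_edge_upper_bound
  exact ⟨1 / 2048, c, by norm_num, hc, 32 ^ 3, fun n hn =>
    ⟨hupper n (le_trans (by norm_num) hn), exists_copy_free_graph hn⟩⟩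
end

section
/- There exists p₀ such that for every prime p ≥ p₀ the following holds: for any u ∈ V₁ and w ∈ V₂, the number of triples (e₁, e₂, e₃) of pairwise distinct edges of H for which there exist vertices v₂ ∈ V₂ and v₃ ∈ V₁ with u, v₂, v₃, w pairwise distinct such that {u,v₂} ⊆ e₁, {v₂,v₃} ⊆ e₂, and {v₃,w} ⊆ e₃ is at most 8. (That is, there are at most 8 Berge 3-paths of type (1,2,1,2) with end vertices u and w.) -/
/-- The conditions required of the set `S₁ ⊆ F_p`. -/
def S1Cond (p : ℕ) (S1 : Set (ZMod p)) : Prop :=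
  ∀ x ∈ S1,
    (2 ≤ x.val ∧ x.val ≤ (p - 1) / 2) ∧
    (∀ w : ZMod p, x ≠ -w ^ 2) ∧
    x ^ 2 - 4 * x + 1 ≠ 0 ∧
    3 * x ≠ 1 ∧ 3 * x ≠ 2 ∧
    10872 * x ^ 5 - 12757 * x ^ 4 + 3369 * x ^ 3 + 2312 * x ^ 2
      - 1176 * x - 144 ≠ 0

/-- `S₂ = F_p \ {0, 1}`. -/
def S2set (p : ℕ) : Set (ZMod p) := {x | x ≠ 0 ∧ x ≠ 1}

/-- The part `V_i = S₁ × S₂ × S₂ × {i}` of the vertex set. -/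
def Vpart (p : ℕ) (S1 : Set (ZMod p)) (i : ℕ) : Set (ZMod p × ZMod p × ZMod p × ℕ) :=
  {v | v.1 ∈ S1 ∧ v.2.1 ∈ S2set p ∧ v.2.2.1 ∈ S2set p ∧ v.2.2.2 = i}

/-- The triple `e(x₁, x₂, x₃, a)`. -/
def hedge (p : ℕ) (x1 x2 x3 a : ZMod p) : Set (ZMod p × ZMod p × ZMod p × ℕ) :=
  {(x1, x2 * x3 + a, x2 ^ 2 * x3 + a, 1),
   (x2, x3 * x1 + a, x3 ^ 2 * x1 + a, 2),
   (x3, x1 * x2 + a, x1 ^ 2 * x2 + a, 3)}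

/-- The edge set of the hypergraph `H`. -/
def Hedges (p : ℕ) (S1 : Set (ZMod p)) : Set (Set (ZMod p × ZMod p × ZMod p × ℕ)) :=
  {E | ∃ x1 x2 x3 a : ZMod p, x1 ∈ S1 ∧ x2 ∈ S1 ∧ x3 ∈ S1 ∧ a ≠ 0 ∧
    E = hedge p x1 x2 x3 a ∧
    E ⊆ Vpart p S1 1 ∪ Vpart p S1 2 ∪ Vpart p S1 3}

/-- The equations relating the third coordinates `q, s, t` of the edges of a Berge path
`u, v₂, v₃, w` and the first coordinates `x`, `r` of `v₂`, `v₃`, once the shifts have been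
eliminated. -/
structure PathSystem {F : Type*} [Field F] (A B D E G x q r s t : F) : Prop where
  eq_u : x * (x - 1) * q = D
  eq_v₂ : q * (q - 1) * A = s * (s - 1) * r
  eq_v₃ : x * (x - 1) * s = B * (B - 1) * t
  eq_w : t * (t - 1) * r = E
  shift : G - x * q + q * A - s * r + x * s - B * t + t * r = 0

namespace PathSystem

variable {F : Type*} [Field F] {A B D E G K x q r s t : F}

lemma s_eq (h : PathSystem A B D E G x q r s t) (hD : D ≠ 0) (hK : K * D = B * (B - 1)) :
    s = K * t * q := by
  apply mul_left_cancel₀ hD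
  linear_combination (-s) * h.eq_u + q * h.eq_v₃ - q * t * hK

lemma bilinear (h : PathSystem A B D E G x q r s t) (hD : D ≠ 0) (hq : q ≠ 0)
    (hK : K * D = B * (B - 1)) :
    A * (q - 1) * (t - 1) = K * E * (K * t * q - 1) := by
  have hs := h.s_eq hD hK
  have h₂ := h.eq_v₂
  rw [hs] at h₂
  apply mul_left_cancel₀ hq
  linear_combination (t - 1) * h₂ + K * q * (K * t * q - 1) * h.eq_w

/-- `t` is a fractional linear function of `x * (x - 1)`. -/
lemma fractional (h : PathSystem A B D E G x q r s t) (hD : D ≠ 0) (hq : q ≠ 0)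
    (hK : K * D = B * (B - 1)) :
    t * (A * D - K ^ 2 * D * E - A * (x * (x - 1))) =
      A * D - (A + K * E) * (x * (x - 1)) := by
  linear_combination (x * (x - 1)) * h.bilinear hD hq hK
    - (A * t - A - K ^ 2 * E * t) * h.eq_u

lemma quartic (h : PathSystem A B D E G x q r s t) (hD : D ≠ 0) (hq : q ≠ 0)
    (ht : t ≠ 1) (hK : K * D = B * (B - 1)) :
    K * G * (x * (x - 1)) - K * D * x + K * D * A
      - (A * D - K ^ 2 * D * E - A * (x * (x - 1)))
      + x * K * (K * D) * t - K * B * t * (x * (x - 1)) = 0 := by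
  have hM : A * D - K ^ 2 * D * E - A * (x * (x - 1)) =
      t * r * K * (K * D - x * (x - 1)) := by
    apply mul_left_cancel₀ (sub_ne_zero.2 ht)
    linear_combination h.fractional hD hq hK - K * (K * D - x * (x - 1)) * h.eq_w
  rw [hM]
  linear_combination K * x * (x - 1) * h.shift + K * (x - A) * h.eq_u
    - K * (x - r) * h.eq_v₃ + (K * t * x - K * t * r) * hK

/-- In the degenerate case two consecutive edges coincide, or `x = 1 - B`. -/
lemma of_degenerate (h : PathSystem A B D E G x q r s t) (hD : D ≠ 0) (hA : A ≠ 0)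
    (hq : q ≠ 0) (hq₁ : q ≠ 1) (hK : K * D = B * (B - 1))
    (hdeg : A * (1 - K) = K ^ 2 * E) :
    r = A ∧ s = q ∨ x = B ∧ s = t ∨ x = 1 - B := by
  have hs := h.s_eq hD hK
  have hprod : (K * t - 1) * (K * q - 1) = 0 := by
    apply mul_left_cancel₀ hA
    linear_combination K * h.bilinear hD hq hK - (K * t * q - 1) * hdeg
  rcases mul_eq_zero.1 hprod with h₁ | h₁
  · have hsq : s = q := by linear_combination hs + q * h₁
    refine Or.inl ⟨?_, hsq⟩
    have h₂ := h.eq_v₂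
    rw [hsq] at h₂
    exact (mul_left_cancel₀ (mul_ne_zero hq (sub_ne_zero.2 hq₁)) h₂).symm
  · have hst : s = t := by linear_combination hs + t * h₁
    have hx : (x - B) * (x - (1 - B)) = 0 := by
      apply mul_left_cancel₀ hq
      linear_combination h.eq_u - D * h₁ + q * hK
    rcases mul_eq_zero.1 hx with h₂ | h₂
    · exact Or.inr (Or.inl ⟨sub_eq_zero.1 h₂, hst⟩)
    · exact Or.inr (Or.inr (sub_eq_zero.1 h₂))

/-- Outside the degenerate case, a solution is determined by its value of `x`. -/
lemma unique {q' r' s' t' : F} (h : PathSystem A B D E G x q r s t)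
    (h' : PathSystem A B D E G x q' r' s' t') (hD : D ≠ 0) (hE : E ≠ 0) (hK₀ : K ≠ 0)
    (hK : K * D = B * (B - 1)) (hdeg : A * (1 - K) ≠ K ^ 2 * E) :
    q = q' ∧ r = r' ∧ s = s' ∧ t = t' := by
  have hP : x * (x - 1) ≠ 0 := fun h₀ => hD (by rw [← h.eq_u, h₀, zero_mul])
  have hq₀ : q ≠ 0 := fun h₀ => hD (by rw [← h.eq_u, h₀, mul_zero])
  have hq : q = q' := mul_left_cancel₀ hP (h.eq_u.trans h'.eq_u.symm)
  subst hq
  have hf := h.fractional hD hq₀ hK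
  have hM : A * D - K ^ 2 * D * E - A * (x * (x - 1)) ≠ 0 := by
    intro hM
    rw [hM, mul_zero] at hf
    refine hdeg (mul_left_cancel₀ (mul_ne_zero (mul_ne_zero hD hE) hK₀) ?_)
    linear_combination A * hf + (A + K * E) * hM
  have ht : t = t' := mul_right_cancel₀ hM (hf.trans (h'.fractional hD hq₀ hK).symm)
  subst ht
  have hs : s = s' := mul_left_cancel₀ hP (h.eq_v₃.trans h'.eq_v₃.symm)
  have hT : t * (t - 1) ≠ 0 := fun h₀ => hE (by rw [← h.eq_w, h₀, zero_mul])
  exact ⟨rfl, mul_left_cancel₀ hT (h.eq_w.trans h'.eq_w.symm), hs, rfl⟩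

end PathSystem

open Polynomial in
lemma exists_finset_roots_quartic {F : Type*} [Field F] (c₀ c₁ c₂ c₃ c₄ : F)
    (h : c₃ ≠ 0 ∨ c₄ ≠ 0) :
    ∃ R : Finset F, R.card ≤ 4 ∧
      ∀ x, c₄ * x ^ 4 + c₃ * x ^ 3 + c₂ * x ^ 2 + c₁ * x + c₀ = 0 → x ∈ R := by
  classical
  let Q : F[X] := C c₄ * X ^ 4 + C c₃ * X ^ 3 + C c₂ * X ^ 2 + C c₁ * X + C c₀
  have hQ : Q ≠ 0 := by
    intro hQ
    have h₃ : Q.coeff 3 = c₃ := by simp [Q]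
    have h₄ : Q.coeff 4 = c₄ := by simp [Q]
    rw [hQ, coeff_zero] at h₃ h₄
    exact h.elim (fun h => h h₃.symm) (fun h => h h₄.symm)
  have hdeg : Q.natDegree ≤ 4 := by
    unfold Q
    compute_degree
  refine ⟨Q.roots.toFinset,
    (Multiset.toFinset_card_le _).trans ((card_roots' Q).trans hdeg), fun x hx => ?_⟩
  rw [Multiset.mem_toFinset, mem_roots hQ, IsRoot.def]
  simpa [Q] using hx

/-- Outside the degenerate case, `x` takes at most four values. -/
lemma PathSystem.exists_finset {F : Type*} [Field F] {A B D E K : F} (G : F) (hD : D ≠ 0)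
    (hK₀ : K ≠ 0) (hK : K * D = B * (B - 1)) (hdeg : A * (1 - K) ≠ K ^ 2 * E) :
    ∃ R : Finset F, R.card ≤ 4 ∧ ∀ x q r s t, q ≠ 0 → t ≠ 1 →
      PathSystem A B D E G x q r s t → x ∈ R := by
  set m := A * D - K ^ 2 * D * E with hm
  set f₂ := -(K * G * A) - A ^ 2 + K * B * (A + K * E) with hf₂
  set f₁ := K * G * m - K * D * A ^ 2 + 2 * m * A - K * B * (A * D) with hf₁
  set g₁ := K * D * (A * (1 - K) - K ^ 2 * E) with hg₁
  have hne : -2 * f₂ + g₁ ≠ 0 ∨ f₂ ≠ 0 := by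
    by_contra! hc
    have : g₁ = 0 := by linear_combination hc.1 + 2 * hc.2
    exact mul_ne_zero (mul_ne_zero hK₀ hD) (sub_ne_zero.2 hdeg) this
  obtain ⟨R, hR, hroot⟩ := exists_finset_roots_quartic (K * D * A * m - m ^ 2)
    (K * D * (K * (A * D) - m) - f₁) (f₁ + f₂ - g₁) (-2 * f₂ + g₁) f₂ hne
  refine ⟨R, hR, fun x q r s t hq ht h => hroot x ?_⟩
  rw [hf₁, hf₂, hg₁, hm]
  linear_combination (A * D - K ^ 2 * D * E - A * (x * (x - 1))) * h.quartic hD hq ht hK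
    - (x * K * (K * D) - K * B * (x * (x - 1))) * h.fractional hD hq hK

lemma S1Cond.ne_zero {p : ℕ} {S1 : Set (ZMod p)} (hS : S1Cond p S1) {x : ZMod p}
    (hx : x ∈ S1) : x ≠ 0 := by
  rintro rfl
  have := (hS 0 hx).1.1
  simp at this

lemma S1Cond.ne_one {p : ℕ} {S1 : Set (ZMod p)} (hS : S1Cond p S1) {x : ZMod p}
    (hx : x ∈ S1) : x ≠ 1 := by
  rintro rfl
  have h := (hS 1 hx).1
  have : (1 : ZMod p).val ≤ 1 := ZMod.val_one'' (by omega) |>.le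
  omega

lemma S1Cond.ne_one_sub {p : ℕ} [NeZero p] {S1 : Set (ZMod p)} (hS : S1Cond p S1)
    {x y : ZMod p} (hx : x ∈ S1) (hy : y ∈ S1) : x ≠ 1 - y := by
  intro h
  have h₁ := (hS x hx).1
  have h₂ := (hS y hy).1
  have hsum : ((x.val + y.val : ℕ) : ZMod p) = ((1 : ℕ) : ZMod p) := by
    push_cast
    rw [ZMod.natCast_zmod_val, ZMod.natCast_zmod_val, h]
    ring
  rw [ZMod.natCast_eq_natCast_iff'] at hsum
  rw [Nat.mod_eq_of_lt (by omega), Nat.mod_eq_of_lt (by omega)] at hsum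
  omega

lemma exists_eq_hedge {p : ℕ} {S1 : Set (ZMod p)} {e : Set (ZMod p × ZMod p × ZMod p × ℕ)}
    {u v : ZMod p × ZMod p × ZMod p × ℕ} (he : e ∈ Hedges p S1) (hu : u ∈ Vpart p S1 1)
    (hv : v ∈ Vpart p S1 2) (hue : u ∈ e) (hve : v ∈ e) :
    ∃ x a : ZMod p, x ∈ S1 ∧ e = hedge p u.1 v.1 x a ∧
      u.2.1 = v.1 * x + a ∧ u.2.2.1 = v.1 ^ 2 * x + a ∧
      v.2.1 = x * u.1 + a ∧ v.2.2.1 = x ^ 2 * u.1 + a := by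
  obtain ⟨x₁, x₂, x₃, a, -, -, h₃, -, rfl, -⟩ := he
  have hu' : u = (x₁, x₂ * x₃ + a, x₂ ^ 2 * x₃ + a, 1) := by
    rcases hue with h | h | h
    · exact h
    all_goals
      have := hu.2.2.2
      rw [h] at this
      simp at this
  have hv' : v = (x₂, x₃ * x₁ + a, x₃ ^ 2 * x₁ + a, 2) := by
    rcases hve with h | h | h
    · have := hv.2.2.2
      rw [h] at this
      simp at this
    · exact h
    · have := hv.2.2.2
      rw [h] at this
      simp at this
  exact ⟨x₃, a, h₃, by simp [hu', hv']⟩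

lemma Set.encard_le_of_finset_witness {α β : Type*} {T : Set α} {R : Finset β} {n : ℕ}
    (hR : R.card ≤ n) (W : α → β → Prop) (hex : ∀ a ∈ T, ∃ b ∈ R, W a b)
    (huniq : ∀ a ∈ T, ∀ a' ∈ T, ∀ b, W a b → W a' b → a = a') : T.encard ≤ n := by
  rcases T.eq_empty_or_nonempty with rfl | ⟨a₀, ha₀⟩
  · simp
  have : Nonempty β := ⟨(hex a₀ ha₀).choose⟩
  choose! φ hφ using hex
  calc T.encard ≤ (R : Set β).encard :=
        Set.encard_le_encard_of_injOn (fun a ha => (hφ a ha).1) fun a ha a' ha' h =>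
          huniq a ha a' ha' (φ a) (hφ a ha).2 (by rw [h]; exact (hφ a' ha').2)
    _ ≤ n := by rw [Set.encard_coe_eq_coe_finsetCard]; exact_mod_cast hR

/-- The edges of a Berge path from `(A, b, c, 1)` to `(B, d, e, 2)` whose inner vertices have
first coordinates `x` and `r`, expressed through a solution of `PathSystem`. -/
def PathWitness (p : ℕ) [Fact p.Prime] (S1 : Set (ZMod p)) (A b c B d e : ZMod p)
    (T : Set (ZMod p × ZMod p × ZMod p × ℕ) × Set (ZMod p × ZMod p × ZMod p × ℕ) ×
      Set (ZMod p × ZMod p × ZMod p × ℕ)) (x : ZMod p) : Prop :=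
  ∃ q r s t : ZMod p, PathSystem A B (c - b) (e - d) (b - d) x q r s t ∧
    (x ∈ S1 ∧ q ∈ S1 ∧ r ∈ S1 ∧ t ∈ S1) ∧
    T = (hedge p A x q (b - x * q), hedge p r x s (b - x * q + q * A - s * r),
      hedge p r B t (d - t * r)) ∧
    ¬ (r = A ∧ s = q) ∧ ¬ (x = B ∧ s = t)

theorem stmt_16 :
    ∃ p0 : ℕ, ∀ p : ℕ, p.Prime → p0 ≤ p →
      ∀ S1 : Set (ZMod p), S1Cond p S1 →
        ∀ u ∈ Vpart p S1 1, ∀ w ∈ Vpart p S1 2,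
          {t : Set (ZMod p × ZMod p × ZMod p × ℕ) ×
               Set (ZMod p × ZMod p × ZMod p × ℕ) ×
               Set (ZMod p × ZMod p × ZMod p × ℕ) |
            t.1 ∈ Hedges p S1 ∧ t.2.1 ∈ Hedges p S1 ∧ t.2.2 ∈ Hedges p S1 ∧
            t.1 ≠ t.2.1 ∧ t.1 ≠ t.2.2 ∧ t.2.1 ≠ t.2.2 ∧
            ∃ v2 ∈ Vpart p S1 2, ∃ v3 ∈ Vpart p S1 1,
              [u, v2, v3, w].Pairwise (· ≠ ·) ∧
              {u, v2} ⊆ t.1 ∧ {v2, v3} ⊆ t.2.1 ∧ {v3, w} ⊆ t.2.2}.encard ≤ 8 := by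
  refine ⟨0, fun p hp _ S1 hS u hu w hw => ?_⟩
  have : Fact p.Prime := ⟨hp⟩
  set T := {t : Set (ZMod p × ZMod p × ZMod p × ℕ) × Set (ZMod p × ZMod p × ZMod p × ℕ) ×
    Set (ZMod p × ZMod p × ZMod p × ℕ) | _}
  obtain ⟨A, b, c, i⟩ := u
  obtain ⟨B, d, e, j⟩ := w
  have hA : A ∈ S1 := hu.1
  have hB : B ∈ S1 := hw.1
  have hwit : ∀ y ∈ T, ∃ x, PathWitness p S1 A b c B d e y x := by
    rintro ⟨e₁, e₂, e₃⟩ ⟨he₁, he₂, he₃, h₁₂, -, h₂₃, ⟨x, v, v', k⟩, hv₂, ⟨r, z, z', l⟩, hv₃,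
      -, hs₁, hs₂, hs₃⟩
    obtain ⟨q, a₁, hq, rfl, hb, hc, h₁, h₁'⟩ :=
      exists_eq_hedge he₁ hu hv₂ (hs₁ (by simp)) (hs₁ (by simp))
    obtain ⟨s, a₂, -, rfl, h₂, h₂', h₃, h₃'⟩ :=
      exists_eq_hedge he₂ hv₃ hv₂ (hs₂ (by simp)) (hs₂ (by simp))
    obtain ⟨t, a₃, ht, rfl, h₄, h₄', hd, he⟩ :=
      exists_eq_hedge he₃ hv₃ hw (hs₃ (by simp)) (hs₃ (by simp))
    dsimp only at *
    have ha₁ : a₁ = b - x * q := by linear_combination -hb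
    have ha₂ : a₂ = a₁ + q * A - s * r := by linear_combination h₁ - h₃
    have ha₃ : a₃ = d - t * r := by linear_combination -hd
    refine ⟨x, q, r, s, t, ⟨?_, ?_, ?_, ?_, ?_⟩, ⟨hv₂.1, hq, hv₃.1, ht⟩, ?_, ?_, ?_⟩
    · linear_combination hb - hc
    · linear_combination h₁ - h₁' - h₃ + h₃'
    · linear_combination h₂ - h₂' - h₄ + h₄'
    · linear_combination hd - he
    · linear_combination hb - h₁ + h₃ - h₂ + h₄ - hd
    · rw [← ha₁, ← ha₂, ← ha₃]
    · rintro ⟨rfl, rfl⟩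
      exact h₁₂ (by rw [ha₂]; ring_nf)
    · rintro ⟨rfl, rfl⟩
      exact h₂₃ (by rw [show a₂ = a₃ by linear_combination h₄ - h₂])
  rcases T.eq_empty_or_nonempty with h₀ | ⟨y₀, hy₀⟩
  · simp [h₀]
  obtain ⟨x₀, q₀, r₀, s₀, t₀, h₀, ⟨hx₀, hq₀, hr₀, ht₀⟩, -, hrs, hxs⟩ := hwit y₀ hy₀
  have hmul : ∀ {x : ZMod p}, x ∈ S1 → x * (x - 1) ≠ 0 := fun hx =>
    mul_ne_zero (hS.ne_zero hx) (sub_ne_zero.2 (hS.ne_one hx))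
  have hD : c - b ≠ 0 := by
    rw [← h₀.eq_u]
    exact mul_ne_zero (hmul hx₀) (hS.ne_zero hq₀)
  have hE : e - d ≠ 0 := by
    rw [← h₀.eq_w]
    exact mul_ne_zero (hmul ht₀) (hS.ne_zero hr₀)
  obtain ⟨K, hK⟩ : ∃ K, K * (c - b) = B * (B - 1) := ⟨_, div_mul_cancel₀ _ hD⟩
  have hK₀ : K ≠ 0 := by
    rintro rfl
    exact hmul hB (by rw [← hK, zero_mul])
  have hdeg : A * (1 - K) ≠ K ^ 2 * (e - d) := fun hdeg => by
    rcases h₀.of_degenerate hD (hS.ne_zero hA) (hS.ne_zero hq₀) (hS.ne_one hq₀) hK hdeg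
      with h | h | h
    · exact hrs h
    · exact hxs h
    · exact hS.ne_one_sub hx₀ hB h
  obtain ⟨R, hR, hmem⟩ := PathSystem.exists_finset (b - d) hD hK₀ hK hdeg
  refine Set.encard_le_of_finset_witness (n := 8) (hR.trans (by norm_num))
    (PathWitness p S1 A b c B d e) (fun y hy => ?_) ?_
  · obtain ⟨x, hx⟩ := hwit y hy
    refine ⟨x, ?_, hx⟩
    obtain ⟨q, r, s, t, h, ⟨-, hq, -, ht⟩, -⟩ := hx
    exact hmem x q r s t (hS.ne_zero hq) (hS.ne_one ht) h
  · rintro y - y' - x ⟨q, r, s, t, h, -, rfl, -⟩ ⟨q', r', s', t', h', -, rfl, -⟩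
    obtain ⟨rfl, rfl, rfl, rfl⟩ := h.unique h' hD hE hK₀ hK hdeg
    rfl
end
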